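/- arXiv:2101.03629 — 8 statements merged into one kernel-verified Lean document; each statement's English description precedes it below -/
import Mathlib

section
/- For every u ∈ ℓ²(ℤ) and every z ∈ [0,∞) it holds that Σ_{n∈ℤ} | Σ_{k∈ℤ} e^{−2z} [Σ_{j∈ℕ₀} z^{2j+n−k} / (Γ(1+j)Γ(j+n−k+1))] u(k) |² < ∞; i.e., the discrete heat semigroup S_z(Δ) maps ℓ²(ℤ) into ℓ²(ℤ). -/
/-- The discrete heat semigroup applied to `u : ℤ → ℝ` at time `z` and site `n`:
`(S_z(Δ)u)(n) = ∑_{k∈ℤ} e^{−2z} [∑_{j∈ℕ} z^{2j+n−k} / (Γ(1+j)Γ(j+n−k+1))] u(k)`.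
Summands with `j+n−k+1 ≤ 0` vanish since `Real.Gamma` vanishes at nonpositive
integers and division by zero is zero in Lean, realizing the convention
`1/Γ(nonpositive integer) = 0`. -/
noncomputable def heatS (z : ℝ) (u : ℤ → ℝ) (n : ℤ) : ℝ :=
  ∑' k : ℤ, Real.exp (-(2 * z)) *
    (∑' j : ℕ, z ^ (2 * (j : ℤ) + (n - k)) /
      (Real.Gamma (1 + (j : ℝ)) * Real.Gamma ((j : ℝ) + ((n - k : ℤ) : ℝ) + 1))) * u k

/-- Cauchy–Schwarz for infinite sums. -/
theorem tsum_sq_le_tsum_mul_tsum {ι : Type*} {r f g : ι → ℝ} (hr : Summable r)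
    (hf : Summable f) (hg : Summable g) (hf0 : ∀ i, 0 ≤ f i) (hg0 : ∀ i, 0 ≤ g i)
    (h : ∀ i, r i ^ 2 ≤ f i * g i) :
    (∑' i, r i) ^ 2 ≤ (∑' i, f i) * ∑' i, g i :=
  le_of_tendsto_of_tendsto' (hr.hasSum.pow 2) (Filter.Tendsto.mul hf.hasSum hg.hasSum) fun s =>
    Finset.sum_sq_le_sum_mul_sum_of_sq_le_mul s (fun i _ => hf0 i) (fun i _ => hg0 i)
      fun i _ => h i

/-- Young's inequality, qualitatively: convolution with a nonnegative summable kernel preserves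
square summability. -/
theorem summable_sq_tsum_sub_mul {G : Type*} [AddCommGroup G] {g u : G → ℝ}
    (hg : Summable g) (hg0 : ∀ i, 0 ≤ g i) (hu : Summable fun k => u k ^ 2) :
    Summable fun n => (∑' k, g (n - k) * u k) ^ 2 := by
  have hprod : Summable fun p : G × G => g (p.1 - p.2) * u p.2 ^ 2 := by
    have h := hg.mul_of_nonneg hu hg0 fun k => sq_nonneg (u k)
    have hinj : Function.Injective fun p : G × G => (p.1 - p.2, p.2) := by
      rintro ⟨a, b⟩ ⟨c, d⟩ h
      simp only [Prod.mk.injEq] at h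
      obtain ⟨h, rfl⟩ := h
      simpa using h
    exact h.comp_injective hinj
  refine Summable.of_nonneg_of_le (fun n => sq_nonneg _) (fun n => ?_)
    (hprod.prod.mul_left (∑' k, g k))
  have hgn : Summable fun k => g (n - k) := (Equiv.subLeft n).summable_iff.mpr hg
  have hgu : Summable fun k => g (n - k) * u k ^ 2 := hprod.prod_factor n
  have hr : Summable fun k => g (n - k) * u k := by
    refine Summable.of_norm_bounded (hgn.add hgu) fun k => ?_
    rw [Real.norm_eq_abs, abs_mul, abs_of_nonneg (hg0 _)]
    have : |u k| ≤ 1 + u k ^ 2 := by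
      rw [← sq_abs]
      nlinarith [sq_nonneg (|u k| - 1), abs_nonneg (u k)]
    nlinarith [mul_le_mul_of_nonneg_left this (hg0 (n - k))]
  have hsum : ∑' k, g (n - k) = ∑' k, g k := (Equiv.subLeft n).tsum_eq g
  rw [← hsum]
  exact tsum_sq_le_tsum_mul_tsum hr hgn hgu (fun k => hg0 _)
    (fun k => mul_nonneg (hg0 _) (sq_nonneg _)) fun k => (by ring : _ = _).le

/-- The summand of the discrete heat kernel at site `m` on the line `j + m = l ≥ 0`. -/
theorem heatTerm_of_nat (z : ℝ) (j l : ℕ) :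
    z ^ (2 * (j : ℤ) + ((l : ℤ) - j)) /
      (Real.Gamma (1 + (j : ℝ)) * Real.Gamma ((j : ℝ) + (((l : ℤ) - j : ℤ) : ℝ) + 1)) =
    (z ^ j / j.factorial) * (z ^ l / l.factorial) := by
  have h1 : 2 * (j : ℤ) + ((l : ℤ) - j) = ((j + l : ℕ) : ℤ) := by push_cast; ring
  have h2 : (j : ℝ) + (((l : ℤ) - j : ℤ) : ℝ) + 1 = (l : ℝ) + 1 := by push_cast; ring
  rw [h1, h2, zpow_natCast, add_comm 1 (j : ℝ), Real.Gamma_nat_eq_factorial,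
    Real.Gamma_nat_eq_factorial, pow_add, mul_div_mul_comm]

/-- The summand of the discrete heat kernel vanishes for `j + m < 0`. -/
theorem heatTerm_of_neg (z : ℝ) (m : ℤ) (j : ℕ) (h : (j : ℤ) + m < 0) :
    z ^ (2 * (j : ℤ) + m) /
      (Real.Gamma (1 + (j : ℝ)) * Real.Gamma ((j : ℝ) + (m : ℝ) + 1)) = 0 := by
  obtain ⟨n, hn⟩ : ∃ n : ℕ, (j : ℤ) + m + 1 = -n := ⟨(-((j : ℤ) + m + 1)).toNat, by omega⟩
  have h' : (j : ℝ) + (m : ℝ) + 1 = -(n : ℝ) := by exact_mod_cast hn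
  rw [h', Real.Gamma_neg_nat_eq_zero, mul_zero, div_zero]

/-- Either `j + m < 0`, or `m` lies on the line `j + m = l` for some natural number `l`. -/
theorem heatTerm_cases (m : ℤ) (j : ℕ) :
    (j : ℤ) + m < 0 ∨ ∃ l : ℕ, m = (l : ℤ) - j := by
  by_cases h : (j : ℤ) + m < 0
  · exact Or.inl h
  · exact Or.inr ⟨((j : ℤ) + m).toNat, by omega⟩

theorem heatTerm_nonneg {z : ℝ} (hz : 0 ≤ z) (m : ℤ) (j : ℕ) :
    0 ≤ z ^ (2 * (j : ℤ) + m) /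
      (Real.Gamma (1 + (j : ℝ)) * Real.Gamma ((j : ℝ) + (m : ℝ) + 1)) := by
  rcases heatTerm_cases m j with h | ⟨l, rfl⟩
  · exact (heatTerm_of_neg z m j h).ge
  · rw [heatTerm_of_nat]
    positivity

theorem summable_heatTerm {z : ℝ} (hz : 0 ≤ z) :
    Summable fun p : ℤ × ℕ => z ^ (2 * (p.2 : ℤ) + p.1) /
      (Real.Gamma (1 + (p.2 : ℝ)) * Real.Gamma ((p.2 : ℝ) + (p.1 : ℝ) + 1)) := by
  have hinj : Function.Injective fun q : ℕ × ℕ => ((q.2 : ℤ) - q.1, q.1) := by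
    rintro ⟨a, b⟩ ⟨c, d⟩ h
    simp only [Prod.mk.injEq] at h ⊢
    omega
  refine (hinj.summable_iff ?_).mp ?_
  · rintro ⟨m, j⟩ hp
    rcases heatTerm_cases m j with h | ⟨l, rfl⟩
    · exact heatTerm_of_neg z m j h
    · exact absurd ⟨(j, l), rfl⟩ hp
  · have hexp := Real.summable_pow_div_factorial z
    refine (hexp.mul_of_nonneg hexp (fun j => ?_) fun l => ?_).congr fun q => ?_
    · simp only [Pi.zero_apply]
      positivity
    · simp only [Pi.zero_apply]
      positivity
    · exact (heatTerm_of_nat z q.1 q.2).symm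

/-- For every `u ∈ ℓ²(ℤ)` and every `z ∈ [0,∞)` the discrete heat
semigroup `S_z(Δ)` maps `ℓ²(ℤ)` into `ℓ²(ℤ)`:
`∑_{n∈ℤ} |(S_z(Δ)u)(n)|² < ∞`. -/
theorem stmt3 (u : ℤ → ℝ) (hu : Summable (fun k : ℤ => (u k) ^ 2))
    (z : ℝ) (hz : 0 ≤ z) :
    Summable (fun n : ℤ => (heatS z u n) ^ 2) := by
  exact summable_sq_tsum_sub_mul
    (g := fun m : ℤ => Real.exp (-(2 * z)) * ∑' j : ℕ, z ^ (2 * (j : ℤ) + m) /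
      (Real.Gamma (1 + (j : ℝ)) * Real.Gamma ((j : ℝ) + (m : ℝ) + 1)))
    ((summable_heatTerm hz).prod.mul_left _)
    (fun m => mul_nonneg (Real.exp_pos _).le (tsum_nonneg fun j => heatTerm_nonneg hz m j)) hu
end

section
/- For every u ∈ ℓ²(ℤ) and every z ∈ [0,∞) it holds that ‖S_z(Δ)u‖₂ ≤ ‖u‖₂; i.e., the discrete heat semigroup is a contraction on ℓ²(ℤ). -/
/-- Jensen's inequality for the square, with respect to a discrete probability weight. -/
lemma sq_tsum_mul_le_of_hasSum_one {ι : Type*} {w u : ι → ℝ} (hw : ∀ i, 0 ≤ w i)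
    (hw1 : HasSum w 1) (hwu : Summable fun i => w i * u i ^ 2) :
    (∑' i, w i * u i) ^ 2 ≤ ∑' i, w i * u i ^ 2 := by
  have hs : Summable fun i => w i * u i := by
    refine Summable.of_norm_bounded (hw1.summable.add hwu) fun i => ?_
    rw [Real.norm_eq_abs, abs_mul, abs_of_nonneg (hw i)]
    nlinarith [mul_nonneg (hw i) (sq_nonneg (|u i| - 1)), sq_abs (u i), hw i,
      mul_nonneg (hw i) (abs_nonneg (u i))]
  set a := ∑' i, w i * u i
  have h := (hwu.hasSum.sub (hs.hasSum.mul_left (2 * a))).add (hw1.mul_left (a ^ 2))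
  have h0 := h.nonneg fun i => by
    have := mul_nonneg (hw i) (sq_nonneg (u i - a))
    linarith
  change 0 ≤ _ - 2 * a * a + _ at h0
  nlinarith

/-- Convolution with a probability weight on an additive group is a contraction on `ℓ²`. -/
lemma tsum_sq_convolution_le {G : Type*} [AddCommGroup G] {w u : G → ℝ} (hw : ∀ i, 0 ≤ w i)
    (hw1 : HasSum w 1) (hu : Summable fun k => u k ^ 2) :
    ∑' n, (∑' k, w (n - k) * u k) ^ 2 ≤ ∑' k, u k ^ 2 := by
  let e : G × G ≃ G × G :=
    { toFun := fun p => (p.1 - p.2, p.2)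
      invFun := fun p => (p.1 + p.2, p.2)
      left_inv := fun p => by simp
      right_inv := fun p => by simp }
  have hprod : HasSum (fun p : G × G => w p.1 * u p.2 ^ 2) (1 * ∑' k, u k ^ 2) :=
    hw1.mul hu.hasSum (hw1.summable.mul_of_nonneg hu hw fun k => sq_nonneg (u k))
  have hconv : HasSum (fun p : G × G => w (p.1 - p.2) * u p.2 ^ 2) (∑' k, u k ^ 2) := by
    rw [one_mul] at hprod
    exact (e.hasSum_iff (f := fun p : G × G => w p.1 * u p.2 ^ 2)).mpr hprod
  have hfib : ∀ n, Summable fun k => w (n - k) * u k ^ 2 := fun n =>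
    hconv.summable.prod_factor n
  have hsum := hconv.prod_fiberwise fun n => (hfib n).hasSum
  have hle : ∀ n, (∑' k, w (n - k) * u k) ^ 2 ≤ ∑' k, w (n - k) * u k ^ 2 := fun n =>
    sq_tsum_mul_le_of_hasSum_one (fun k => hw (n - k))
      (((Equiv.subLeft n).hasSum_iff (f := w)).mpr hw1) (hfib n)
  exact ((hsum.summable.of_nonneg_of_le (fun n => sq_nonneg _) hle).tsum_le_tsum hle
    hsum.summable).trans_eq hsum.tsum_eq

/-- `1 / Γ(i + 1)` vanishes at negative integers `i`. -/
lemma Gamma_intCast_add_one_of_neg {i : ℤ} (hi : i < 0) : Real.Gamma ((i : ℝ) + 1) = 0 := by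
  obtain ⟨n, rfl⟩ : ∃ n : ℕ, i = -(n : ℤ) - 1 := ⟨(-i - 1).toNat, by omega⟩
  rw [Real.Gamma_eq_zero_iff]
  exact ⟨n, by push_cast; ring⟩

lemma hasSum_int_zpow_div_Gamma (z : ℝ) :
    HasSum (fun i : ℤ => z ^ i / Real.Gamma ((i : ℝ) + 1)) (Real.exp z) := by
  refine (Function.Injective.hasSum_iff (g := ((↑) : ℕ → ℤ)) Nat.cast_injective
    fun i hi => ?_).mp ?_
  · have : i < 0 := by
      by_contra! h
      exact hi ⟨i.toNat, Int.toNat_of_nonneg h⟩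
    rw [Gamma_intCast_add_one_of_neg this, div_zero]
  · have h := NormedSpace.expSeries_div_hasSum_exp z
    rw [← Real.exp_eq_exp_ℝ] at h
    refine h.congr_fun fun n => ?_
    simp [Real.Gamma_nat_eq_factorial]

/-- The generic summand of the discrete heat kernel splits as a product. -/
lemma zpow_div_Gamma_mul_Gamma (z : ℝ) (j : ℕ) (m : ℤ) :
    z ^ (2 * (j : ℤ) + m) / (Real.Gamma (1 + (j : ℝ)) * Real.Gamma ((j : ℝ) + (m : ℝ) + 1)) =
      z ^ (m + j) / Real.Gamma (((m + j : ℤ) : ℝ) + 1) * (z ^ j / j.factorial) := by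
  have hc : (j : ℝ) + (m : ℝ) + 1 = ((m + j : ℤ) : ℝ) + 1 := by push_cast; ring
  rw [hc, add_comm 1 (j : ℝ), Real.Gamma_nat_eq_factorial]
  rcases lt_or_ge (m + j) 0 with h | h
  · rw [Gamma_intCast_add_one_of_neg h]
    simp
  · obtain ⟨i, hi⟩ := Int.eq_ofNat_of_zero_le h
    have he : 2 * (j : ℤ) + m = ((i + j : ℕ) : ℤ) := by push_cast; omega
    rw [he, hi, zpow_natCast, zpow_natCast, pow_add]
    ring

/-- The discrete heat kernel. -/
noncomputable def heatKernel (z : ℝ) (m : ℤ) : ℝ :=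
  Real.exp (-(2 * z)) * ∑' j : ℕ, z ^ (2 * (j : ℤ) + m) /
    (Real.Gamma (1 + (j : ℝ)) * Real.Gamma ((j : ℝ) + (m : ℝ) + 1))

lemma zpow_div_Gamma_intCast_nonneg {z : ℝ} (hz : 0 ≤ z) (i : ℤ) :
    0 ≤ z ^ i / Real.Gamma ((i : ℝ) + 1) := by
  rcases lt_or_ge i 0 with h | h
  · simp [Gamma_intCast_add_one_of_neg h]
  · have : (0 : ℝ) ≤ i := by exact_mod_cast h
    exact div_nonneg (zpow_nonneg hz i) (Real.Gamma_nonneg_of_nonneg (by linarith))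

lemma heatKernel_nonneg {z : ℝ} (hz : 0 ≤ z) (m : ℤ) : 0 ≤ heatKernel z m := by
  refine mul_nonneg (Real.exp_nonneg _) (tsum_nonneg fun j => ?_)
  rw [zpow_div_Gamma_mul_Gamma]
  exact mul_nonneg (zpow_div_Gamma_intCast_nonneg hz _) (by positivity)

lemma hasSum_heatKernel {z : ℝ} (hz : 0 ≤ z) : HasSum (heatKernel z) 1 := by
  let e : ℤ × ℕ ≃ ℤ × ℕ :=
    { toFun := fun p => (p.1 + p.2, p.2)
      invFun := fun p => (p.1 - p.2, p.2)
      left_inv := fun p => by simp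
      right_inv := fun p => by simp }
  have hexp := NormedSpace.expSeries_div_hasSum_exp z
  rw [← Real.exp_eq_exp_ℝ] at hexp
  have hint := hasSum_int_zpow_div_Gamma z
  have hprod := e.hasSum_iff.mpr (hint.mul hexp (hint.summable.mul_of_nonneg hexp.summable
    (zpow_div_Gamma_intCast_nonneg hz) fun j => by positivity))
  have hfib := (hprod.prod_fiberwise fun m =>
    (hprod.summable.prod_factor m).hasSum).mul_left (Real.exp (-(2 * z)))
  have hone : Real.exp (-(2 * z)) * (Real.exp z * Real.exp z) = 1 := by
    rw [← Real.exp_add, ← Real.exp_add]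
    ring_nf
    exact Real.exp_zero
  rw [hone] at hfib
  refine hfib.congr_fun fun m => ?_
  simp only [heatKernel, zpow_div_Gamma_mul_Gamma]
  rfl

/-- For every `u ∈ ℓ²(ℤ)` and every `z ∈ [0,∞)` it holds that
`‖S_z(Δ)u‖₂ ≤ ‖u‖₂`; the discrete heat semigroup is a contraction on `ℓ²(ℤ)`. -/
theorem stmt5 (u : ℤ → ℝ) (hu : Summable (fun k : ℤ => (u k) ^ 2))
    (z : ℝ) (hz : 0 ≤ z) :
    Real.sqrt (∑' n : ℤ, (heatS z u n) ^ 2) ≤ Real.sqrt (∑' n : ℤ, (u n) ^ 2) := by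
  exact Real.sqrt_le_sqrt
    (tsum_sq_convolution_le (heatKernel_nonneg hz) (hasSum_heatKernel hz) hu)
end

section
/- For every u ∈ ℓ²(ℤ), every n ∈ ℤ, and every z ∈ (0,∞), the real-valued function z ↦ (S_z(Δ)u)(n) is differentiable at z with derivative (d/dz)(S_z(Δ)u)(n) = (Δ S_z(Δ)u)(n). -/
open Nat in
/-- The heat semigroup without its factor `e^{-2z}`, as a sum over the numbers `p.1` of right steps
and `p.2` of left steps. -/
noncomputable def stepSum (z : ℝ) (u : ℤ → ℝ) (n : ℤ) : ℝ :=
  ∑' p : ℕ × ℕ, z ^ p.1 / (p.1)! * (z ^ p.2 / (p.2)!) * u (n - p.1 + p.2)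

open Nat in
theorem summable_deriv_expSeries (z : ℝ) :
    Summable fun a : ℕ => (a : ℝ) * z ^ (a - 1) / a ! := by
  rw [← summable_nat_add_iff 1]
  refine (Real.summable_pow_div_factorial z).congr fun a => ?_
  have : (a ! : ℝ) ≠ 0 := by positivity
  have h1 : (a : ℝ) + 1 ≠ 0 := by positivity
  rw [Nat.factorial_succ]
  push_cast
  field_simp

theorem summable_mul_bounded {x y : ℕ → ℝ} (hx : Summable x) (hy : Summable y)
    {v : ℕ × ℕ → ℝ} {C : ℝ} (hv : ∀ p, |v p| ≤ C) :
    Summable fun p : ℕ × ℕ => x p.1 * y p.2 * v p := by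
  have h := (hx.norm.mul_of_nonneg hy.norm (fun _ => norm_nonneg _)
    (fun _ => norm_nonneg _)).mul_right C
  refine Summable.of_norm_bounded h fun p => ?_
  rw [norm_mul, norm_mul]
  gcongr
  exact hv p

open Nat in
theorem summable_stepSum {u : ℤ → ℝ} {C : ℝ} (hu : ∀ k, |u k| ≤ C) (n : ℤ) (z : ℝ) :
    Summable fun p : ℕ × ℕ =>
      z ^ p.1 / (p.1)! * (z ^ p.2 / (p.2)!) * u (n - p.1 + p.2) :=
  summable_mul_bounded (Real.summable_pow_div_factorial z) (Real.summable_pow_div_factorial z)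
    fun p => hu (n - p.1 + p.2)

open Nat in
theorem heatS_eq_exp_mul_stepSum {u : ℤ → ℝ} {C : ℝ} (hu : ∀ k, |u k| ≤ C) (n : ℤ) (z : ℝ) :
    heatS z u n = Real.exp (-(2 * z)) * stepSum z u n := by
  set G : ℤ × ℕ → ℝ := fun q => z ^ (2 * (q.2 : ℤ) + (n - q.1)) /
      (Real.Gamma (1 + (q.2 : ℝ)) * Real.Gamma ((q.2 : ℝ) + ((n - q.1 : ℤ) : ℝ) + 1)) * u q.1
    with hG
  set e : ℕ × ℕ → ℤ × ℕ := fun p => (n - p.1 + p.2, p.2) with he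
  have he_inj : Function.Injective e := by
    rintro ⟨a, b⟩ ⟨c, d⟩ h
    simp only [he, Prod.mk.injEq] at h ⊢
    omega
  have hGe : ∀ p, G (e p) = z ^ p.1 / (p.1)! * (z ^ p.2 / (p.2)!) * u (n - p.1 + p.2) := by
    rintro ⟨a, b⟩
    have h1 : (2 * (b : ℤ) + (n - (n - a + b))) = ((a + b : ℕ) : ℤ) := by push_cast; ring
    have h2 : (b : ℝ) + ((n - (n - a + b) : ℤ) : ℝ) + 1 = (a : ℝ) + 1 := by push_cast; ring
    simp only [hG, he]
    rw [h1, h2, zpow_natCast, Real.Gamma_nat_eq_factorial, add_comm 1 (b : ℝ),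
      Real.Gamma_nat_eq_factorial, pow_add, mul_comm (b ! : ℝ), mul_div_mul_comm]
  have hG0 : ∀ q, q ∉ Set.range e → G q = 0 := by
    rintro ⟨k, j⟩ hq
    have hneg : (j : ℤ) + (n - k) < 0 := by
      by_contra! h
      refine hq ⟨(((j : ℤ) + (n - k)).toNat, j), ?_⟩
      simp only [he, Prod.mk.injEq, and_true]
      omega
    have hΓ : Real.Gamma ((j : ℝ) + ((n - k : ℤ) : ℝ) + 1) = 0 := by
      obtain ⟨m, hm⟩ := Int.eq_ofNat_of_zero_le (show 0 ≤ -((j : ℤ) + (n - k) + 1) by omega)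
      have : (j : ℝ) + ((n - k : ℤ) : ℝ) + 1 = -(m : ℝ) := by
        have h : (j : ℤ) + (n - k) + 1 = -(m : ℤ) := by omega
        exact_mod_cast h
      rw [this, Real.Gamma_neg_nat_eq_zero]
    simp only [hG, hΓ, mul_zero, div_zero, zero_mul]
  have hGs : Summable G := by
    rw [← he_inj.summable_iff hG0]
    exact (summable_stepSum hu n z).congr fun p => (hGe p).symm
  have hsum : ∑' q, G q = stepSum z u n := by
    rw [← he_inj.tsum_eq (f := G) fun q hq => by
      by_contra h
      exact hq (hG0 q h)]
    exact tsum_congr hGe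
  rw [← hsum, hGs.tsum_prod, ← tsum_mul_left]
  refine tsum_congr fun k => ?_
  simp only [hG]
  rw [tsum_mul_right, mul_assoc]

open Nat in
theorem tsum_deriv_left (v : ℕ × ℕ → ℝ) (z : ℝ) :
    ∑' p : ℕ × ℕ, (p.1 * z ^ (p.1 - 1) / (p.1)!) * (z ^ p.2 / (p.2)!) * v p =
      ∑' p : ℕ × ℕ, z ^ p.1 / (p.1)! * (z ^ p.2 / (p.2)!) * v (p.1 + 1, p.2) := by
  have hinj : Function.Injective fun p : ℕ × ℕ => (p.1 + 1, p.2) := by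
    rintro ⟨a, b⟩ ⟨c, d⟩ h
    simpa using h
  rw [← hinj.tsum_eq]
  · refine tsum_congr fun p => ?_
    have h0 : ((p.1)! : ℝ) ≠ 0 := by positivity
    have h1 : (p.1 : ℝ) + 1 ≠ 0 := by positivity
    congr 2
    simp only [Nat.factorial_succ, Nat.add_sub_cancel]
    push_cast
    field_simp
  · rintro ⟨a, b⟩ h
    rcases a with _ | a
    · simp at h
    · exact ⟨(a, b), rfl⟩

open Nat in
theorem tsum_deriv_right (v : ℕ × ℕ → ℝ) (z : ℝ) :
    ∑' p : ℕ × ℕ, z ^ p.1 / (p.1)! * (p.2 * z ^ (p.2 - 1) / (p.2)!) * v p =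
      ∑' p : ℕ × ℕ, z ^ p.1 / (p.1)! * (z ^ p.2 / (p.2)!) * v (p.1, p.2 + 1) := by
  have h := tsum_deriv_left (v ∘ Prod.swap) z
  rw [← (Equiv.prodComm ℕ ℕ).tsum_eq, ← (Equiv.prodComm ℕ ℕ).tsum_eq
    (fun p : ℕ × ℕ => z ^ p.1 / (p.1)! * (z ^ p.2 / (p.2)!) * v (p.1, p.2 + 1))]
  simpa [mul_comm, mul_left_comm, mul_assoc] using h

open Nat in
theorem hasDerivAt_stepSum {u : ℤ → ℝ} {C : ℝ} (hu : ∀ k, |u k| ≤ C) (n : ℤ) (z : ℝ) :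
    HasDerivAt (fun w => stepSum w u n) (stepSum z u (n - 1) + stepSum z u (n + 1)) z := by
  set R : ℝ := |z| + 1
  have hC : ∀ p : ℕ × ℕ, |u (n - p.1 + p.2)| ≤ C := fun p => hu _
  have hC' : ∀ p : ℕ × ℕ, |(fun _ => C : ℕ × ℕ → ℝ) p| ≤ C := fun p =>
    (abs_of_nonneg ((abs_nonneg _).trans (hu 0))).le
  have hE := Real.summable_pow_div_factorial
  have hD := summable_deriv_expSeries
  have key := hasDerivAt_tsum_of_isPreconnected (t := Metric.ball (0 : ℝ) R)
    (g := fun (p : ℕ × ℕ) (w : ℝ) => w ^ p.1 / (p.1)! * (w ^ p.2 / (p.2)!) * u (n - p.1 + p.2))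
    (g' := fun (p : ℕ × ℕ) (w : ℝ) =>
      (p.1 * w ^ (p.1 - 1) / (p.1)!) * (w ^ p.2 / (p.2)!) * u (n - p.1 + p.2) +
      w ^ p.1 / (p.1)! * (p.2 * w ^ (p.2 - 1) / (p.2)!) * u (n - p.1 + p.2))
    ((summable_mul_bounded (hD R) (hE R) hC').add (summable_mul_bounded (hE R) (hD R) hC'))
    Metric.isOpen_ball (convex_ball _ _).isPreconnected
    (fun p w _ => by
      have h := (((hasDerivAt_pow p.1 w).div_const ((p.1)! : ℝ)).mul
        ((hasDerivAt_pow p.2 w).div_const ((p.2)! : ℝ))).mul_const (u (n - p.1 + p.2))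
      rwa [add_mul] at h)
    (fun p w hw => by
      have hw' : |w| ≤ R := by simpa using (mem_ball_zero_iff.mp hw).le
      refine (norm_add_le _ _).trans ?_
      simp only [norm_mul, norm_div, norm_pow, Real.norm_eq_abs, Nat.abs_cast]
      gcongr <;> exact hC p)
    (y₀ := z) (y := z) (by simp [R]) (summable_stepSum hu n z) (by simp [R])
  refine key.congr_deriv ?_
  rw [(summable_mul_bounded (hD z) (hE z) hC).tsum_add (summable_mul_bounded (hE z) (hD z) hC),
    tsum_deriv_left fun p : ℕ × ℕ => u (n - p.1 + p.2),
    tsum_deriv_right fun p : ℕ × ℕ => u (n - p.1 + p.2)]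
  unfold stepSum
  congr 1 <;> refine tsum_congr fun p => ?_ <;> congr 2 <;> push_cast <;> ring

/-- For every `u ∈ ℓ²(ℤ)`, every `n ∈ ℤ`, and every `z ∈ (0,∞)`, the
map `z ↦ (S_z(Δ)u)(n)` is differentiable at `z` with derivative
`(Δ S_z(Δ)u)(n) = (S_z(Δ)u)(n−1) − 2(S_z(Δ)u)(n) + (S_z(Δ)u)(n+1)`. -/
theorem stmt6 (u : ℤ → ℝ) (hu : Summable (fun k : ℤ => (u k) ^ 2))
    (n : ℤ) (z : ℝ) (hz : 0 < z) :
    HasDerivAt (fun w : ℝ => heatS w u n)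
      (heatS z u (n - 1) - 2 * heatS z u n + heatS z u (n + 1)) z := by
  have hC : ∀ k, |u k| ≤ √(∑' k, u k ^ 2) := fun k =>
    Real.abs_le_sqrt (hu.le_tsum k fun _ _ => sq_nonneg _)
  simp only [heatS_eq_exp_mul_stepSum hC]
  have hexp : HasDerivAt (fun w : ℝ => Real.exp (-(2 * w))) (Real.exp (-(2 * z)) * -(2 * 1)) z :=
    ((hasDerivAt_id z).const_mul 2).neg.exp
  refine (hexp.mul (hasDerivAt_stepSum hC n z)).congr_deriv ?_
  ring
end

section
/- For every u ∈ ℓ²(ℤ) and every z ∈ [0,∞) it holds that ‖(S_z(Δ) − I)u‖₂ ≤ z ‖Δu‖₂, where I denotes the identity operator on ℓ²(ℤ). -/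
/-- The discrete Laplace operator `(Δu)(n) = u(n−1) − 2u(n) + u(n+1)`. -/
def discLap (u : ℤ → ℝ) (n : ℤ) : ℝ := u (n - 1) - 2 * u n + u (n + 1)

section PoissonSemigroup

theorem hasSum_exp_real (x : ℝ) : HasSum (fun n : ℕ => x ^ n / n.factorial) (Real.exp x) := by
  rw [Real.exp_eq_exp_ℝ]
  exact NormedSpace.expSeries_div_hasSum_exp x

theorem hasSum_natCast_mul_exp_real (x : ℝ) :
    HasSum (fun n : ℕ => (n : ℝ) * (x ^ n / n.factorial)) (x * Real.exp x) := by
  rw [← hasSum_nat_add_iff' 1]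
  simp only [Finset.range_one, Finset.sum_singleton, Nat.cast_zero, zero_mul, sub_zero]
  refine ((hasSum_exp_real x).mul_left x).congr_fun ?_
  intro n
  rw [Nat.factorial_succ]
  push_cast
  field_simp
  ring

theorem norm_pow_apply_sub_le {E : Type*} [NormedAddCommGroup E] [NormedSpace ℝ E]
    (T : Module.End ℝ E) {c : ℝ} (hc : 0 ≤ c) (hT : ∀ x, ‖T x‖ ≤ c * ‖x‖) (x : E) (n : ℕ) :
    c * ‖(T ^ n) x - c ^ n • x‖ ≤ n * c ^ n * ‖T x - c • x‖ := by
  induction n with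
  | zero => simp
  | succ n ih =>
    have h : (T ^ (n + 1)) x - c ^ (n + 1) • x
        = T ((T ^ n) x - c ^ n • x) + c ^ n • (T x - c • x) := by
      rw [pow_succ', Module.End.mul_apply, map_sub, map_smul, pow_succ]
      module
    calc c * ‖(T ^ (n + 1)) x - c ^ (n + 1) • x‖
        ≤ c * (c * ‖(T ^ n) x - c ^ n • x‖ + c ^ n * ‖T x - c • x‖) := by
          rw [h]
          gcongr
          refine (norm_add_le _ _).trans (add_le_add (hT _) ?_)
          rw [norm_smul, Real.norm_of_nonneg (pow_nonneg hc n)]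
      _ ≤ c * (n * c ^ n * ‖T x - c • x‖ + c ^ n * ‖T x - c • x‖) := by gcongr
      _ = (n + 1 : ℕ) * c ^ (n + 1) * ‖T x - c • x‖ := by push_cast; ring

/-- If `‖T‖ ≤ 2`, then `exp (z (T - 2)) x - x`, written as a Poisson-weighted series, has norm at
most `z ‖(T - 2) x‖`. -/
theorem exists_hasSum_norm_le {E : Type*} [NormedAddCommGroup E] [NormedSpace ℝ E]
    [CompleteSpace E] (T : Module.End ℝ E) (hT : ∀ x, ‖T x‖ ≤ 2 * ‖x‖) (x : E)
    {z : ℝ} (hz : 0 ≤ z) :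
    ∃ w : E, HasSum (fun n : ℕ =>
        (Real.exp (-(2 * z)) * (z ^ n / n.factorial)) • ((T ^ n) x - (2 : ℝ) ^ n • x)) w ∧
      ‖w‖ ≤ z * ‖T x - (2 : ℝ) • x‖ := by
  have hg : HasSum (fun n : ℕ => Real.exp (-(2 * z)) * ‖T x - (2 : ℝ) • x‖ / 2 *
      ((n : ℝ) * ((2 * z) ^ n / n.factorial))) (z * ‖T x - (2 : ℝ) • x‖) := by
    convert! (hasSum_natCast_mul_exp_real (2 * z)).mul_left
      (Real.exp (-(2 * z)) * ‖T x - (2 : ℝ) • x‖ / 2) using 1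
    have h : Real.exp (-(2 * z)) * Real.exp (2 * z) = 1 := by rw [← Real.exp_add]; simp
    linear_combination -z * ‖T x - (2 : ℝ) • x‖ * h
  have hb (n : ℕ) : ‖(Real.exp (-(2 * z)) * (z ^ n / n.factorial)) •
      ((T ^ n) x - (2 : ℝ) ^ n • x)‖ ≤ Real.exp (-(2 * z)) * ‖T x - (2 : ℝ) • x‖ / 2 *
      ((n : ℝ) * ((2 * z) ^ n / n.factorial)) := by
    have hn := norm_pow_apply_sub_le T zero_le_two hT x n
    have hc : 0 ≤ Real.exp (-(2 * z)) * (z ^ n / n.factorial) := by positivity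
    rw [norm_smul, Real.norm_of_nonneg hc]
    calc _ ≤ Real.exp (-(2 * z)) * (z ^ n / n.factorial) *
          (n * 2 ^ n * ‖T x - (2 : ℝ) • x‖ / 2) := by gcongr; linarith
      _ = _ := by rw [mul_pow]; ring
  exact ⟨_, (Summable.of_norm_bounded hg.summable hb).hasSum, tsum_of_norm_bounded hg hb⟩

end PoissonSemigroup

section Shift

/-- The space `ℓ²(ℤ)`. -/
abbrev ellTwo := lp (fun _ : ℤ => ℝ) 2

theorem memℓp_two_iff {u : ℤ → ℝ} : Memℓp u 2 ↔ Summable fun k => u k ^ 2 := by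
  rw [memℓp_gen_iff (by norm_num)]
  simp

theorem ellTwo.norm_eq_sqrt (f : ellTwo) : ‖f‖ = √(∑' n, f n ^ 2) := by
  rw [lp.norm_eq_tsum_rpow (by norm_num), Real.sqrt_eq_rpow]
  simp

/-- Translation by `a` on `ℓ²(ℤ)`. -/
def ellTwo.shift (a : ℤ) : Module.End ℝ ellTwo where
  toFun f := ⟨fun n => f (n + a), memℓp_two_iff.2 <|
    (Equiv.addRight a).summable_iff (f := fun n => f n ^ 2) |>.2 (memℓp_two_iff.1 f.2)⟩
  map_add' _ _ := rfl
  map_smul' _ _ := rfl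

@[simp]
theorem ellTwo.shift_apply (a : ℤ) (f : ellTwo) (n : ℤ) : shift a f n = f (n + a) := rfl

theorem ellTwo.norm_shift (a : ℤ) (f : ellTwo) : ‖shift a f‖ = ‖f‖ := by
  rw [norm_eq_sqrt, norm_eq_sqrt]
  exact congrArg _ ((Equiv.addRight a).tsum_eq fun n => f n ^ 2)

theorem ellTwo.shift_mul (a b : ℤ) : shift a * shift b = shift (a + b) := by
  ext f n
  simp [add_assoc]

theorem ellTwo.shift_pow (a : ℤ) (j : ℕ) : shift a ^ j = shift (j * a) := by
  induction j with
  | zero => ext f n; simp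
  | succ j ih => rw [pow_succ, ih, shift_mul]; push_cast; ring_nf

theorem ellTwo.shift_add_shift_pow_apply (f : ellTwo) (N : ℕ) (n : ℤ) :
    ((shift 1 + shift (-1)) ^ N) f n =
      ∑ p ∈ Finset.HasAntidiagonal.antidiagonal N, (N.choose p.1 : ℝ) * f (n + (p.1 - p.2)) := by
  have hc : Commute (shift 1) (shift (-1)) := by
    rw [Commute, SemiconjBy, shift_mul, shift_mul, add_comm]
  rw [hc.add_pow', LinearMap.sum_apply, lp.coeFn_sum, Finset.sum_apply]
  refine Finset.sum_congr rfl fun p _ => ?_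
  have h : (p.1 : ℤ) * 1 + p.2 * -1 = p.1 - p.2 := by ring
  rw [shift_pow, shift_pow, shift_mul, h, LinearMap.smul_apply, ← Nat.cast_smul_eq_nsmul ℝ,
    lp.coeFn_smul, Pi.smul_apply, shift_apply, smul_eq_mul]

end Shift

section HeatKernel

theorem summable_heat_series (f : ellTwo) {z : ℝ} (hz : 0 ≤ z) (n : ℤ) :
    Summable fun p : ℕ × ℕ =>
      z ^ p.1 / p.1.factorial * (z ^ p.2 / p.2.factorial) * f (n + (p.1 - p.2)) := by
  have h := (hasSum_exp_real z).summable
  have h0 : 0 ≤ fun n : ℕ => z ^ n / n.factorial := fun n => by positivity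
  refine Summable.of_norm_bounded ((h.mul_of_nonneg h h0 h0).mul_right ‖f‖) fun p => ?_
  rw [norm_mul, Real.norm_of_nonneg (by positivity)]
  gcongr
  exact lp.norm_apply_le_norm two_ne_zero f _

theorem hasSum_shift_pow (f : ellTwo) {z : ℝ} (hz : 0 ≤ z) (n : ℤ) :
    HasSum (fun N : ℕ => z ^ N / N.factorial *
        ((ellTwo.shift 1 + ellTwo.shift (-1)) ^ N) f n)
      (∑' p : ℕ × ℕ,
        z ^ p.1 / p.1.factorial * (z ^ p.2 / p.2.factorial) * f (n + (p.1 - p.2))) := by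
  refine ((Finset.HasAntidiagonal.sigmaAntidiagonalEquivProd.hasSum_iff).2
    (summable_heat_series f hz n).hasSum).sigma fun N => ?_
  rw [ellTwo.shift_add_shift_pow_apply, Finset.mul_sum, ← Finset.sum_coe_sort]
  convert! hasSum_fintype _ using 1
  refine Finset.sum_congr rfl fun p _ => ?_
  obtain ⟨⟨i, j⟩, hp⟩ := p
  obtain rfl := Finset.HasAntidiagonal.mem_antidiagonal.1 hp
  have h : ((i + j).choose i : ℝ) * i.factorial * j.factorial = (i + j).factorial := by
    rw [Nat.choose_symm_add]
    exact_mod_cast Nat.add_choose_mul_factorial_mul_factorial i j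
  simp only [Function.comp, Finset.HasAntidiagonal.sigmaAntidiagonalEquivProd_apply]
  rw [← h, pow_add]
  have : ((i + j).choose i : ℝ) ≠ 0 := by
    exact_mod_cast (Nat.choose_pos (Nat.le_add_right i j)).ne'
  field_simp

theorem heatS_eq_tsum (f : ellTwo) {z : ℝ} (hz : 0 ≤ z) (n : ℤ) :
    heatS z f n = Real.exp (-(2 * z)) * ∑' p : ℕ × ℕ,
      z ^ p.1 / p.1.factorial * (z ^ p.2 / p.2.factorial) * f (n + (p.1 - p.2)) := by
  set F : ℤ × ℕ → ℝ := fun q => z ^ (2 * (q.2 : ℤ) + (n - q.1)) /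
      (Real.Gamma (1 + (q.2 : ℝ)) * Real.Gamma ((q.2 : ℝ) + ((n - q.1 : ℤ) : ℝ) + 1)) * f q.1
    with hF
  let g : ℕ × ℕ → ℤ × ℕ := fun p => (n + (p.1 - p.2), p.1)
  have hg : Function.Injective g := by
    rintro ⟨a, b⟩ ⟨c, d⟩ h
    simp only [g, Prod.mk.injEq] at h ⊢
    omega
  have hFg : F ∘ g = fun p =>
      z ^ p.1 / p.1.factorial * (z ^ p.2 / p.2.factorial) * f (n + (p.1 - p.2)) := by
    funext ⟨a, b⟩
    simp only [hF, g, Function.comp]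
    have h1 : 2 * (a : ℤ) + (n - (n + (a - b))) = ((a + b : ℕ) : ℤ) := by push_cast; ring
    have h2 : (a : ℝ) + ((n - (n + (a - b)) : ℤ) : ℝ) + 1 = b + 1 := by push_cast; ring
    rw [h1, h2, add_comm 1 (a : ℝ), Real.Gamma_nat_eq_factorial, Real.Gamma_nat_eq_factorial,
      zpow_natCast, pow_add, mul_div_mul_comm]
  have hF0 : ∀ q ∉ Set.range g, F q = 0 := by
    rintro ⟨k, j⟩ hq
    have hneg : (j : ℤ) + (n - k) < 0 := by
      by_contra! h
      refine hq ⟨(j, ((j : ℤ) + (n - k)).toNat), ?_⟩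
      simp only [g, Prod.mk.injEq, and_true, Int.toNat_of_nonneg h]
      ring
    obtain ⟨m, hm⟩ := Int.eq_ofNat_of_zero_le (a := -((j : ℤ) + (n - k) + 1)) (by omega)
    have h : (j : ℝ) + ((n - k : ℤ) : ℝ) + 1 = -(m : ℝ) := by
      have : (j : ℤ) + (n - k) + 1 = -(m : ℤ) := by omega
      exact_mod_cast this
    simp only [hF]
    rw [h, Real.Gamma_neg_nat_eq_zero, mul_zero, div_zero, zero_mul]
  have hsum := (hg.hasSum_iff hF0).1
    ((summable_heat_series f hz n).hasSum.congr_fun (congrFun hFg))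
  rw [← hsum.tsum_eq, hsum.summable.tsum_prod, ← tsum_mul_left, heatS]
  refine tsum_congr fun k => ?_
  rw [mul_assoc, ← tsum_mul_right]

end HeatKernel

/-- For every `u ∈ ℓ²(ℤ)` and every `z ∈ [0,∞)` it holds that
`‖(S_z(Δ) − I)u‖₂ ≤ z ‖Δu‖₂`. -/
theorem stmt7 (u : ℤ → ℝ) (hu : Summable (fun k : ℤ => (u k) ^ 2))
    (z : ℝ) (hz : 0 ≤ z) :
    Real.sqrt (∑' n : ℤ, (heatS z u n - u n) ^ 2)
      ≤ z * Real.sqrt (∑' n : ℤ, (discLap u n) ^ 2) := by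
  let f : ellTwo := ⟨u, memℓp_two_iff.2 hu⟩
  let T : Module.End ℝ ellTwo := ellTwo.shift 1 + ellTwo.shift (-1)
  have hT (x : ellTwo) : ‖T x‖ ≤ 2 * ‖x‖ := by
    refine (norm_add_le _ _).trans ?_
    rw [ellTwo.norm_shift, ellTwo.norm_shift, two_mul]
  obtain ⟨w, hw, hle⟩ := exists_hasSum_norm_le T hT f hz
  have hlap (n : ℤ) : (T f - (2 : ℝ) • f) n = discLap u n := by
    change u (n + 1) + u (n + -1) - 2 * u n = u (n - 1) - 2 * u n + u (n + 1)
    rw [← sub_eq_add_neg]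
    ring
  have hheat (n : ℤ) : w n = heatS z u n - u n := by
    have h1 := hw.mapL (lp.evalCLM ℝ (fun _ : ℤ => ℝ) 2 n)
    have h2 := ((hasSum_shift_pow f hz n).mul_left (Real.exp (-(2 * z)))).sub
      ((hasSum_exp_real (2 * z)).mul_left (Real.exp (-(2 * z)) * u n))
    rw [← heatS_eq_tsum f hz n, mul_right_comm, ← Real.exp_add, neg_add_cancel, Real.exp_zero,
      one_mul] at h2
    refine (h1.congr_fun fun N => ?_).unique h2
    change _ = Real.exp (-(2 * z)) * (z ^ N / N.factorial) * ((T ^ N) f n - 2 ^ N * u n)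
    rw [mul_pow]
    ring
  rw [ellTwo.norm_eq_sqrt, ellTwo.norm_eq_sqrt] at hle
  simpa only [hlap, hheat] using hle
end

section
/- Let m ∈ ℕ and s ∈ (m−1, m). Then there exists C ∈ ℝ such that for every k ∈ ℤ with |k| ≥ m it holds that | Γ(|k| − s)/Γ(|k| + 1 + s) − 1/|k|^{1+2s} | ≤ C / |k|^{2+2s}. -/
open Filter Asymptotics in
/-- If `f = 1 + O(l)` and `g = 1 + O(l)` with `l` bounded, then `f * g = 1 + O(l)`. -/
theorem isBigO_mul_sub_one {α : Type*} {F : Filter α} {f g l : α → ℝ}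
    (hl : l =O[F] (fun _ => (1 : ℝ)))
    (hf : (fun x => f x - 1) =O[F] l) (hg : (fun x => g x - 1) =O[F] l) :
    (fun x => f x * g x - 1) =O[F] l := by
  have h : (fun x => (f x - 1) * (g x - 1)) =O[F] l := by
    simpa using hf.mul (hg.trans hl)
  refine ((h.add hf).add hg).congr_left fun x => ?_
  ring

open Filter Asymptotics Topology in
/-- If `f = 1 + O(l)` and `g = 1 + O(l)` with `l → 0`, then `f / g = 1 + O(l)`. -/
theorem isBigO_div_sub_one {α : Type*} {F : Filter α} {f g l : α → ℝ}
    (hl : Tendsto l F (𝓝 0))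
    (hf : (fun x => f x - 1) =O[F] l) (hg : (fun x => g x - 1) =O[F] l) :
    (fun x => f x / g x - 1) =O[F] l := by
  have hg1 : Tendsto g F (𝓝 1) := by
    simpa using (hg.trans_tendsto hl).add_const 1
  have hinv : (fun x => (g x)⁻¹) =O[F] (fun _ => (1 : ℝ)) :=
    (hg1.inv₀ one_ne_zero).isBigO_one ℝ
  have h : (fun x => ((f x - 1) - (g x - 1)) * (g x)⁻¹) =O[F] l := by
    simpa using (hf.sub hg).mul hinv
  refine h.congr' ?_ EventuallyEq.rfl
  filter_upwards [hg1.eventually_ne one_ne_zero] with x hx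
  field_simp
  ring

/-- Wendel's upper bound for a quotient of Gamma values. -/
theorem Real.Gamma_add_le_Gamma_mul_rpow {x t : ℝ} (hx : 0 < x) (ht0 : 0 < t) (ht1 : t < 1) :
    Real.Gamma (x + t) ≤ Real.Gamma x * x ^ t := by
  have h := Real.Gamma_mul_add_mul_le_rpow_Gamma_mul_rpow_Gamma (s := x) (t := x + 1)
    (a := 1 - t) (b := t) hx (by linarith) (by linarith) ht0 (by ring)
  have hG := Real.Gamma_pos_of_pos hx
  rw [Real.Gamma_add_one hx.ne', Real.mul_rpow hx.le hG.le,
    mul_left_comm, ← Real.rpow_add hG, sub_add_cancel, Real.rpow_one, mul_comm] at h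
  rw [mul_comm (Real.Gamma x)]
  convert h using 2
  ring

/-- `Γ(x + t) / (Γ(x) x ^ t)` is within `1 / x` of `1` for `0 ≤ t < 1`. -/
theorem Real.abs_Gamma_add_div_sub_one_le {x t : ℝ} (hx : 0 < x) (ht0 : 0 ≤ t) (ht1 : t < 1) :
    |Real.Gamma (x + t) / (Real.Gamma x * x ^ t) - 1| ≤ 1 / x := by
  have hG := Real.Gamma_pos_of_pos hx
  rcases ht0.eq_or_lt with rfl | ht0
  · simp [hG.ne', hx.le]
  have hD : 0 < Real.Gamma x * x ^ t := mul_pos hG (Real.rpow_pos_of_pos hx t)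
  have hup := (div_le_one hD).2 (Real.Gamma_add_le_Gamma_mul_rpow hx ht0 ht1)
  have hxt : 0 < x + t := by linarith
  have hlow := Real.Gamma_add_le_Gamma_mul_rpow hxt (sub_pos.2 ht1) (sub_lt_self 1 ht0)
  rw [add_assoc, add_sub_cancel, Real.Gamma_add_one hx.ne'] at hlow
  have hpow : x ^ t * (x + t) ^ (1 - t) ≤ x + t := by
    calc x ^ t * (x + t) ^ (1 - t) ≤ (x + t) ^ t * (x + t) ^ (1 - t) := by
          gcongr
          linarith
      _ = x + t := by rw [← Real.rpow_add hxt, add_sub_cancel, Real.rpow_one]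
  have hlow' : x / (x + t) ≤ Real.Gamma (x + t) / (Real.Gamma x * x ^ t) := by
    rw [div_le_div_iff₀ hxt hD]
    calc x * (Real.Gamma x * x ^ t) = (x * Real.Gamma x) * x ^ t := by ring
      _ ≤ (Real.Gamma (x + t) * (x + t) ^ (1 - t)) * x ^ t := by gcongr
      _ = Real.Gamma (x + t) * (x ^ t * (x + t) ^ (1 - t)) := by ring
      _ ≤ Real.Gamma (x + t) * (x + t) := by
          have := Real.Gamma_pos_of_pos hxt
          gcongr
  have hbound : 1 - 1 / x ≤ x / (x + t) := by
    rw [one_sub_div hx.ne', div_le_div_iff₀ hx hxt]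
    nlinarith
  have : 0 < 1 / x := by positivity
  rw [abs_le]
  constructor <;> linarith

open Filter Asymptotics in
/-- `Γ(x + a) = Γ(x) x ^ a (1 + O(1 / x))` as `x → ∞`, for every real `a`. -/
theorem Real.isBigO_Gamma_add_div_sub_one (a : ℝ) :
    (fun x : ℝ => Real.Gamma (x + a) / (Real.Gamma x * x ^ a) - 1) =O[atTop]
      (fun x : ℝ => 1 / x) := by
  have hl : Tendsto (fun x : ℝ => 1 / x) atTop (nhds 0) := by
    simpa using tendsto_inv_atTop_zero (𝕜 := ℝ)
  have hfac (b : ℝ) : (fun x : ℝ => (x + b) / x - 1) =O[atTop] (fun x : ℝ => 1 / x) := by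
    refine IsBigO.of_bound |b| ?_
    filter_upwards [eventually_gt_atTop 0] with x hx
    rw [add_div, div_self hx.ne', add_sub_cancel_left, ← norm_eq_abs, ← norm_mul, mul_one_div]
  have hrec (b : ℝ) : ∀ᶠ x : ℝ in atTop,
      Real.Gamma (x + (b + 1)) / (Real.Gamma x * x ^ (b + 1)) =
        Real.Gamma (x + b) / (Real.Gamma x * x ^ b) * ((x + b) / x) := by
    filter_upwards [eventually_gt_atTop 0, eventually_gt_atTop (-b)] with x hx hxb
    have hxb' : x + b ≠ 0 := by linarith
    rw [← add_assoc, Real.Gamma_add_one hxb', Real.rpow_add_one hx.ne']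
    have := (Real.Gamma_pos_of_pos hx).ne'
    have := (Real.rpow_pos_of_pos hx b).ne'
    field_simp
  have key (n : ℤ) : (fun x : ℝ => Real.Gamma (x + (Int.fract a + n)) /
      (Real.Gamma x * x ^ (Int.fract a + n)) - 1) =O[atTop] (fun x : ℝ => 1 / x) := by
    induction n using Int.induction_on with
    | zero =>
      refine IsBigO.of_bound 1 ?_
      filter_upwards [eventually_gt_atTop 0] with x hx
      have h := Real.abs_Gamma_add_div_sub_one_le hx (Int.fract_nonneg a) (Int.fract_lt_one a)
      simpa [abs_of_pos hx] using h
    | succ n ih =>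
      refine (isBigO_mul_sub_one (hl.isBigO_one ℝ) ih
        (hfac (Int.fract a + (n : ℤ)))).congr' ?_ EventuallyEq.rfl
      filter_upwards [hrec (Int.fract a + (n : ℤ))] with x hx
      rw [← hx]
      push_cast
      simp only [add_assoc]
    | pred n ih =>
      set b : ℝ := Int.fract a + ((-n - 1 : ℤ) : ℝ) with hb
      have hb1 : Int.fract a + ((-n : ℤ) : ℝ) = b + 1 := by
        rw [hb]
        push_cast
        ring
      rw [hb1] at ih
      refine (isBigO_div_sub_one hl ih (hfac b)).congr' ?_ EventuallyEq.rfl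
      filter_upwards [hrec b, eventually_gt_atTop 0, eventually_gt_atTop (-b)] with x hx h0 hxb
      have hxb' : x + b ≠ 0 := by linarith
      rw [hx, mul_div_cancel_right₀ _ (div_ne_zero hxb' h0.ne')]
  simpa only [Int.fract_add_floor] using key ⌊a⌋

open Filter Asymptotics in
/-- `Γ(x + a) / Γ(x + b) = x ^ (a - b) + O(x ^ (a - b - 1))` as `x → ∞`. -/
theorem Real.isBigO_Gamma_add_div_Gamma_add_sub_rpow (a b : ℝ) :
    (fun x : ℝ => Real.Gamma (x + a) / Real.Gamma (x + b) - x ^ (a - b)) =O[atTop]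
      (fun x : ℝ => x ^ (a - b - 1)) := by
  have hl : Tendsto (fun x : ℝ => 1 / x) atTop (nhds 0) := by
    simpa using tendsto_inv_atTop_zero (𝕜 := ℝ)
  have h := (isBigO_refl (fun x : ℝ => x ^ (a - b)) atTop).mul
    (isBigO_div_sub_one hl (isBigO_Gamma_add_div_sub_one a) (isBigO_Gamma_add_div_sub_one b))
  refine h.congr' ?_ ?_
  · filter_upwards [eventually_gt_atTop 0, eventually_gt_atTop (-b)] with x hx hxb
    have := (Real.Gamma_pos_of_pos hx).ne'
    have := (Real.Gamma_pos_of_pos (show 0 < x + b by linarith)).ne'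
    have := (Real.rpow_pos_of_pos hx a).ne'
    have := (Real.rpow_pos_of_pos hx b).ne'
    rw [Real.rpow_sub hx]
    field_simp
  · filter_upwards [eventually_gt_atTop 0] with x hx
    rw [Real.rpow_sub_one hx.ne', mul_one_div]

/-- Let `m ∈ ℕ` and `s ∈ (m−1, m)`. Then there exists `C ∈ ℝ` such
that for every `k ∈ ℤ` with `|k| ≥ m` it holds that
`|Γ(|k| − s)/Γ(|k| + 1 + s) − 1/|k|^{1+2s}| ≤ C/|k|^{2+2s}` (real powers). -/
theorem stmt11 (m : ℕ) (hm : 1 ≤ m) (s : ℝ) (hs1 : (m : ℝ) - 1 < s) (hs2 : s < m) :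
    ∃ C : ℝ, ∀ k : ℤ, (m : ℤ) ≤ |k| →
      |Real.Gamma (|(k : ℝ)| - s) / Real.Gamma (|(k : ℝ)| + 1 + s) -
          1 / |(k : ℝ)| ^ (1 + 2 * s)|
        ≤ C / |(k : ℝ)| ^ (2 + 2 * s) := by
  obtain ⟨C, -, hC⟩ := Asymptotics.bound_of_isBigO_nat_atTop
    ((Real.isBigO_Gamma_add_div_Gamma_add_sub_rpow (-s) (1 + s)).comp_tendsto
      (tendsto_natCast_atTop_atTop (R := ℝ)))
  refine ⟨C, fun k hk => ?_⟩
  have habs : |(k : ℝ)| = (k.natAbs : ℝ) := by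
    rw [Nat.cast_natAbs, Int.cast_abs]
  have hpos : (0 : ℝ) < k.natAbs := by
    rw [← habs, abs_pos]
    intro h0
    obtain rfl : k = 0 := by exact_mod_cast h0
    rw [abs_zero] at hk
    omega
  have h := @hC k.natAbs (Real.rpow_pos_of_pos hpos _).ne'
  simp only [Function.comp_apply, Real.norm_eq_abs] at h
  rw [abs_of_pos (Real.rpow_pos_of_pos hpos _),
    show -s - (1 + s) - 1 = -(2 + 2 * s) by ring, show -s - (1 + s) = -(1 + 2 * s) by ring,
    Real.rpow_neg hpos.le, Real.rpow_neg hpos.le, ← sub_eq_add_neg, ← add_assoc] at h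
  rw [habs, one_div, div_eq_mul_inv C]
  exact h
end

section
/- Let m ∈ ℕ and s ∈ (m−1, m). Then (i) for every k ∈ ℤ it holds that K_s(−k) = K_s(k), and (ii) there exists C ∈ ℝ such that for every k ∈ ℤ with k ≠ 0 it holds that |K_s(k)| ≤ C / |k|^{1+2s}. -/
/-- The fractional kernel `K_s : ℤ → ℝ`, defined by `K_s(0) = 0` and
`K_s(k) = −4^s Γ(1/2 + s) Γ(|k| − s) / (√π Γ(−s) Γ(|k| + 1 + s))` for `k ≠ 0`. -/
noncomputable def fracKer (s : ℝ) (k : ℤ) : ℝ :=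
  if k = 0 then 0
  else -((4 : ℝ) ^ s * Real.Gamma (1 / 2 + s) * Real.Gamma (|(k : ℝ)| - s)) /
    (Real.sqrt Real.pi * Real.Gamma (-s) * Real.Gamma (|(k : ℝ)| + 1 + s))

/-- Up to the factor `Γ(x)`, Euler's sequence for `Γ(x)` is `n ^ x * n! / Γ(x + n + 1)`. -/
theorem gammaSeq_eq_div_Gamma {x : ℝ} (hx : ∀ m : ℕ, x ≠ -m) (n : ℕ) :
    Real.GammaSeq x n = Real.Gamma x * ((n : ℝ) ^ x * n.factorial / Real.Gamma (x + n + 1)) := by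
  have hprod : ∀ n : ℕ, Real.Gamma (x + n) = (∏ j ∈ Finset.range n, (x + j)) * Real.Gamma x := by
    intro n
    induction n with
    | zero => simp
    | succ n ih =>
      have hn : x + n ≠ 0 := fun h => hx n (by linarith)
      rw [Finset.prod_range_succ, Nat.cast_succ, ← add_assoc, Real.Gamma_add_one hn, ih]
      ring
  have h0 : Real.Gamma x ≠ 0 := Real.Gamma_ne_zero hx
  have h1 := hprod (n + 1)
  rw [Nat.cast_succ, ← add_assoc] at h1
  rw [Real.GammaSeq, h1]
  field_simp

open Filter Topology in
theorem tendsto_rpow_mul_Gamma_div_Gamma {x y : ℝ} (hx : ∀ m : ℕ, x ≠ -m)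
    (hy : ∀ m : ℕ, y ≠ -m) :
    Tendsto (fun n : ℕ => (n : ℝ) ^ (y - x) * (Real.Gamma (x + n + 1) / Real.Gamma (y + n + 1)))
      atTop (𝓝 1) := by
  have key : ∀ {z : ℝ}, (∀ m : ℕ, z ≠ -m) →
      Tendsto (fun n : ℕ => (n : ℝ) ^ z * n.factorial / Real.Gamma (z + n + 1)) atTop (𝓝 1) := by
    intro z hz
    have h0 : Real.Gamma z ≠ 0 := Real.Gamma_ne_zero hz
    have h := (Real.GammaSeq_tendsto_Gamma z).const_mul (Real.Gamma z)⁻¹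
    simpa only [gammaSeq_eq_div_Gamma hz, inv_mul_cancel_left₀ h0, inv_mul_cancel₀ h0] using h
  have h := (key hy).div (key hx) one_ne_zero
  rw [div_one] at h
  refine h.congr' ?_
  filter_upwards [eventually_gt_atTop 0] with n hn
  have hn' : (0 : ℝ) < n := Nat.cast_pos.mpr hn
  have hf : (n.factorial : ℝ) ≠ 0 := Nat.cast_ne_zero.mpr n.factorial_ne_zero
  have hp := (Real.rpow_pos_of_pos hn' x).ne'
  simp only [Pi.div_apply]
  rw [Real.rpow_sub hn', div_div_div_eq]
  field_simp

theorem fracKer_neg (s : ℝ) (k : ℤ) : fracKer s (-k) = fracKer s k := by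
  simp [fracKer]

/-- Let `m ∈ ℕ` and `s ∈ (m−1, m)`. Then (i) `K_s(−k) = K_s(k)` for
all `k ∈ ℤ`, and (ii) there exists `C ∈ ℝ` with `|K_s(k)| ≤ C/|k|^{1+2s}` for all
`k ≠ 0`. -/
theorem stmt12 (m : ℕ) (hm : 1 ≤ m) (s : ℝ) (hs1 : (m : ℝ) - 1 < s) (hs2 : s < m) :
    (∀ k : ℤ, fracKer s (-k) = fracKer s k) ∧
    ∃ C : ℝ, ∀ k : ℤ, k ≠ 0 → |fracKer s k| ≤ C / |(k : ℝ)| ^ (1 + 2 * s) := by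
  refine ⟨fracKer_neg s, ?_⟩
  have hm' : (1 : ℝ) ≤ m := by exact_mod_cast hm
  have hy : ∀ j : ℕ, s ≠ -j := by
    intro j hj
    have : (0 : ℝ) ≤ j := j.cast_nonneg
    linarith
  have hx : ∀ j : ℕ, -1 - s ≠ -j := by
    intro j hj
    have h1 : (m : ℝ) < j := by linarith
    have h2 : (j : ℝ) < m + 1 := by linarith
    norm_cast at h1 h2
    omega
  obtain ⟨B, hB⟩ := (tendsto_rpow_mul_Gamma_div_Gamma hx hy).abs.bddAbove_range
  set c : ℝ := (4 : ℝ) ^ s * Real.Gamma (1 / 2 + s) / (Real.sqrt Real.pi * Real.Gamma (-s))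
  refine ⟨|c| * B, fun k hk => ?_⟩
  have hk' : 0 < |(k : ℝ)| := abs_pos.mpr (Int.cast_ne_zero.mpr hk)
  have hpow := Real.rpow_pos_of_pos hk' (1 + 2 * s)
  have hbound := hB (Set.mem_range_self k.natAbs)
  simp only [Nat.cast_natAbs, Int.cast_abs] at hbound
  rw [show s - (-1 - s) = 1 + 2 * s by ring,
    show -1 - s + |(k : ℝ)| + 1 = |(k : ℝ)| - s by ring,
    show s + |(k : ℝ)| + 1 = |(k : ℝ)| + 1 + s by ring, abs_mul, abs_of_pos hpow] at hbound
  have hK : fracKer s k =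
      -(c * (Real.Gamma (|(k : ℝ)| - s) / Real.Gamma (|(k : ℝ)| + 1 + s))) := by
    rw [fracKer, if_neg hk, div_mul_div_comm, neg_div]
  rw [le_div_iff₀ hpow, hK, abs_neg, abs_mul, mul_assoc]
  gcongr
  rwa [mul_comm]
end

section
/- Let m ∈ ℕ and s ∈ (m−1, m). Then the series Σ_{k=1}^∞ Γ(k − s)/Γ(k + 1 + s) converges and Σ_{k=1}^∞ Γ(k − s)/Γ(k + 1 + s) = −Γ(−s) / (2 Γ(1 + s)). -/
open Finset in
theorem gammaSeq_mul_Gamma_add_nat_add_one (z : ℝ) (hz : ∀ k : ℕ, z ≠ -k) (n : ℕ) :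
    Real.GammaSeq z n * Real.Gamma (n + 1 + z) =
      (n : ℝ) ^ z * n.factorial * Real.Gamma z := by
  have hne (k : ℕ) : z + k ≠ 0 := fun h => hz k (by linarith)
  have hprod (k : ℕ) :
      Real.Gamma (k + z) = Real.Gamma z * ∏ j ∈ range k, (z + j) := by
    induction k with
    | zero => simp
    | succ k ih =>
      rw [prod_range_succ, ← mul_assoc, ← ih, Nat.cast_add_one,
        show (k : ℝ) + 1 + z = (k + z) + 1 by ring,
        Real.Gamma_add_one (by rw [add_comm]; exact hne k)]
      ring
  have h0 : ∏ j ∈ range (n + 1), (z + (j : ℝ)) ≠ 0 :=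
    prod_ne_zero_iff.mpr fun j _ => hne j
  have h := hprod (n + 1)
  rw [Nat.cast_add_one] at h
  rw [h, Real.GammaSeq]
  field_simp

open Filter Topology in
theorem tendsto_Gamma_sub_div_Gamma_add {s : ℝ} (hs : 0 < s) (hns : ∀ k : ℕ, s ≠ k) :
    Tendsto (fun n : ℕ => Real.Gamma (n + 1 - s) / Real.Gamma (n + 1 + s)) atTop (𝓝 0) := by
  have hz : ∀ k : ℕ, -s ≠ -k := fun k h => hns k (neg_injective h)
  have hz' : ∀ k : ℕ, s ≠ -k := fun k h => by
    have : (0 : ℝ) ≤ k := k.cast_nonneg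
    linarith
  have hG := Real.Gamma_ne_zero hz
  have hG' := Real.Gamma_ne_zero hz'
  have hpow : Tendsto (fun n : ℕ => (n : ℝ) ^ (-(2 * s))) atTop (𝓝 0) :=
    (tendsto_rpow_neg_atTop (by positivity)).comp tendsto_natCast_atTop_atTop
  have hseq := Real.GammaSeq_tendsto_Gamma (-s)
  have hlim := (((Real.GammaSeq_tendsto_Gamma s).div hseq hG).mul hpow).const_mul
    (Real.Gamma (-s) / Real.Gamma s)
  simp only [mul_zero] at hlim
  refine hlim.congr' ?_
  filter_upwards [eventually_gt_atTop 0, hseq.eventually_ne hG] with n hn hne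
  have hn' : (0 : ℝ) < n := Nat.cast_pos.mpr hn
  have h1 := gammaSeq_mul_Gamma_add_nat_add_one s hz' n
  have h2 := gammaSeq_mul_Gamma_add_nat_add_one (-s) hz n
  rw [← sub_eq_add_neg] at h2
  have hpos : Real.Gamma (n + 1 + s) ≠ 0 := (Real.Gamma_pos_of_pos (by positivity)).ne'
  have hp : (n : ℝ) ^ (-s) = (n : ℝ) ^ (-(2 * s)) * (n : ℝ) ^ s := by
    rw [← Real.rpow_add hn']
    ring_nf
  rw [hp] at h2
  generalize (n : ℝ) ^ (-(2 * s)) = p at h2 ⊢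
  simp only [Pi.div_apply]
  field_simp
  linear_combination p * Real.Gamma (-s) * h1 - Real.Gamma s * h2

open Finset in
theorem sum_range_Gamma_sub_div_Gamma_add {s : ℝ} (hs : 0 < s) (hns : ∀ k : ℕ, s ≠ k) (n : ℕ) :
    ∑ j ∈ range n, Real.Gamma (((j : ℝ) + 1) - s) / Real.Gamma (((j : ℝ) + 1) + 1 + s) =
      (Real.Gamma (1 - s) / Real.Gamma (1 + s) -
        Real.Gamma (n + 1 - s) / Real.Gamma (n + 1 + s)) / (2 * s) := by
  induction n with
  | zero => simp
  | succ n ih =>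
    have hn : (n : ℝ) + 1 - s ≠ 0 := fun h => hns (n + 1) (by push_cast; linarith)
    have hp : 0 < (n : ℝ) + 1 + s := by positivity
    have hG := (Real.Gamma_pos_of_pos hp).ne'
    have hG1 : Real.Gamma (1 + s) ≠ 0 := (Real.Gamma_pos_of_pos (by positivity)).ne'
    rw [sum_range_succ, ih, Nat.cast_add_one,
      show (n : ℝ) + 1 + 1 - s = (n + 1 - s) + 1 by ring,
      show (n : ℝ) + 1 + 1 + s = (n + 1 + s) + 1 by ring,
      Real.Gamma_add_one hn, Real.Gamma_add_one hp.ne']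
    field_simp
    ring


/-- Let `m ∈ ℕ` and `s ∈ (m−1, m)`. Then the series
`∑_{k=1}^∞ Γ(k−s)/Γ(k+1+s)` converges with sum `−Γ(−s)/(2Γ(1+s))`.
(The series over `k ≥ 1` is indexed here by `k = j + 1`, `j ∈ ℕ`.) -/
theorem stmt15 (m : ℕ) (hm : 1 ≤ m) (s : ℝ) (hs1 : (m : ℝ) - 1 < s) (hs2 : s < m) :
    HasSum
      (fun j : ℕ =>
        Real.Gamma (((j : ℝ) + 1) - s) / Real.Gamma (((j : ℝ) + 1) + 1 + s))
      (-Real.Gamma (-s) / (2 * Real.Gamma (1 + s))) := by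
  have hm' : (1 : ℝ) ≤ m := by exact_mod_cast hm
  have hs : 0 < s := by linarith
  have hns : ∀ k : ℕ, s ≠ k := by
    rintro k rfl
    have h1 : k < m := by exact_mod_cast hs2
    have h2 : m < k + 1 := by
      have : (m : ℝ) < k + 1 := by linarith
      exact_mod_cast this
    omega
  have hval : -Real.Gamma (-s) / (2 * Real.Gamma (1 + s)) =
      (Real.Gamma (1 - s) / Real.Gamma (1 + s) - 0) / (2 * s) := by
    rw [show 1 - s = -s + 1 by ring, Real.Gamma_add_one (neg_ne_zero.mpr hs.ne')]
    have : Real.Gamma (1 + s) ≠ 0 := (Real.Gamma_pos_of_pos (by positivity)).ne'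
    field_simp
    ring
  have hlim := ((tendsto_Gamma_sub_div_Gamma_add hs hns).const_sub
    (Real.Gamma (1 - s) / Real.Gamma (1 + s))).div_const (2 * s)
  rw [← hval] at hlim
  simp only [← sum_range_Gamma_sub_div_Gamma_add hs hns] at hlim
  rw [← hasSum_nat_add_iff' m, hasSum_iff_tendsto_nat_of_nonneg]
  · refine (((Filter.tendsto_add_atTop_iff_nat m).mpr hlim).sub_const _).congr fun n => ?_
    rw [add_comm n m, Finset.sum_range_add, add_sub_cancel_left]
    simp only [add_comm m]
  · intro j
    have hj : (0 : ℝ) ≤ j := j.cast_nonneg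
    push_cast
    exact div_nonneg (Real.Gamma_nonneg_of_nonneg (by linarith))
      (Real.Gamma_nonneg_of_nonneg (by linarith))
end

section
/- Let m ∈ ℕ and s ∈ (m−1, m). Then for every u ∈ ℓ²(ℤ) and every n ∈ ℤ it holds that ((−Δ)^s u)(n) = Σ_{k∈ℤ} K_s(n − k) (u(n) − u(k)), where the left-hand side is the discrete fractional Laplace operator of order s defined via the heat-semigroup integral and the right-hand side series converges absolutely. -/
/-- The negative discrete Laplace operator `(−Δu)(n) = 2u(n) − u(n−1) − u(n+1)`. -/
def negLap (u : ℤ → ℝ) : ℤ → ℝ := fun n => 2 * u n - u (n - 1) - u (n + 1)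

open MeasureTheory Set Filter Topology

theorem hasSum_integral_of_nonneg_of_hasSum {ι : Type*} [Countable ι] {α : Type*}
    [MeasurableSpace α] {μ : Measure α} {F : ι → α → ℝ} {f : α → ℝ}
    (hF : ∀ i, AEStronglyMeasurable (F i) μ) (h0 : ∀ᵐ a ∂μ, ∀ i, 0 ≤ F i a)
    (hs : ∀ᵐ a ∂μ, HasSum (fun i => F i a) (f a)) (hf : Integrable f μ) :
    HasSum (fun i => ∫ a, F i a ∂μ) (∫ a, f a ∂μ) := by
  refine hasSum_integral_of_dominated_convergence F hF (fun i => ?_)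
    (hs.mono fun a h => h.summable) (hf.congr (hs.mono fun a h => h.tsum_eq.symm)) hs
  filter_upwards [h0] with a ha
  rw [Real.norm_of_nonneg (ha i)]

theorem integrableOn_rpow_mul_exp_neg_mul {a r : ℝ} (ha : 0 < a) (hr : 0 < r) :
    IntegrableOn (fun t : ℝ => t ^ (a - 1) * Real.exp (-(r * t))) (Ioi 0) := by
  by_contra h
  have h1 := Real.integral_rpow_mul_exp_neg_mul_Ioi ha hr
  rw [integral_undef h] at h1
  have := Real.Gamma_pos_of_pos ha
  have : 0 < (1 / r) ^ a * Real.Gamma a := by positivity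
  linarith

theorem hasSum_Gamma_add_mul_pow_div_factorial {a x : ℝ} (ha : 0 < a) (hx0 : 0 < x) (hx1 : x < 1) :
    HasSum (fun j : ℕ => Real.Gamma (j + a) * x ^ j / j.factorial)
      (Real.Gamma a * (1 - x) ^ (-a)) := by
  have key := hasSum_integral_of_nonneg_of_hasSum (μ := volume.restrict (Ioi (0 : ℝ)))
    (F := fun (j : ℕ) t => (t ^ (a - 1) * Real.exp (-(1 * t))) * ((t * x) ^ j / j.factorial))
    (f := fun t => t ^ (a - 1) * Real.exp (-((1 - x) * t)))
    (fun j => Measurable.aestronglyMeasurable (by fun_prop))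
    (by
      filter_upwards [ae_restrict_mem measurableSet_Ioi] with t ht j
      have : 0 < t := ht
      positivity)
    (by
      filter_upwards with t
      have h := (NormedSpace.expSeries_div_hasSum_exp (t * x)).mul_left
        (t ^ (a - 1) * Real.exp (-(1 * t)))
      rw [← Real.exp_eq_exp_ℝ, mul_assoc, ← Real.exp_add] at h
      convert! h using 3
      ring)
    (integrableOn_rpow_mul_exp_neg_mul ha (by linarith))
  rw [Real.integral_rpow_mul_exp_neg_mul_Ioi ha (by linarith)] at key
  convert! key using 1
  · ext j
    have : ∫ t in Ioi (0 : ℝ), (t ^ (a - 1) * Real.exp (-(1 * t))) * ((t * x) ^ j / j.factorial)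
        = ∫ t in Ioi (0 : ℝ), (t ^ ((j + a) - 1) * Real.exp (-(1 * t))) * (x ^ j / j.factorial) := by
      refine setIntegral_congr_fun measurableSet_Ioi fun t ht => ?_
      have ht : 0 < t := ht
      have : t ^ ((j + a) - 1) = t ^ (a - 1) * t ^ j := by
        rw [← Real.rpow_natCast, ← Real.rpow_add ht]; ring_nf
      simp only [this, mul_pow]
      ring
    rw [this, integral_mul_const, Real.integral_rpow_mul_exp_neg_mul_Ioi (by positivity) one_pos]
    simp [mul_div_assoc]
  · rw [Real.rpow_neg (by linarith), one_div, Real.inv_rpow (by linarith), mul_comm]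

theorem integral_Ioo_rpow_mul_one_sub_rpow {p q : ℝ} (hp : 0 < p) (hq : 0 < q) :
    ∫ x in Ioo (0 : ℝ) 1, x ^ (p - 1) * (1 - x) ^ (q - 1) = ProbabilityTheory.beta p q := by
  have hb := ProbabilityTheory.beta_pos hp hq
  have h := ProbabilityTheory.lintegral_betaPDF_eq_one hp hq
  rw [ProbabilityTheory.lintegral_betaPDF] at h
  have h2 : ∫ x in Ioo (0 : ℝ) 1,
      1 / ProbabilityTheory.beta p q * x ^ (p - 1) * (1 - x) ^ (q - 1) = 1 := by
    rw [integral_eq_lintegral_of_nonneg_ae, h, ENNReal.toReal_one]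
    · filter_upwards [ae_restrict_mem measurableSet_Ioo] with x hx
      have := hx.1
      have : 0 < 1 - x := by linarith [hx.2]
      simp only [Pi.zero_apply]
      positivity
    · exact Measurable.aestronglyMeasurable (by fun_prop)
  simp only [mul_assoc] at h2
  rw [integral_const_mul] at h2
  field_simp at h2
  exact h2

theorem integrableOn_Ioo_rpow_mul_one_sub_rpow {p q : ℝ} (hp : 0 < p) (hq : 0 < q) :
    IntegrableOn (fun x : ℝ => x ^ (p - 1) * (1 - x) ^ (q - 1)) (Ioo 0 1) := by
  by_contra h
  have h1 := integral_Ioo_rpow_mul_one_sub_rpow hp hq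
  rw [integral_undef h] at h1
  exact (ProbabilityTheory.beta_pos hp hq).ne h1

/-- Gauss's summation theorem for the hypergeometric series at `1`, positive parameters. -/
theorem hasSum_Gamma_mul_Gamma_div_Gamma {a b c : ℝ} (ha : 0 < a) (hb : 0 < b) (hc : a + b < c) :
    HasSum (fun j : ℕ => Real.Gamma (j + a) * Real.Gamma (j + b) /
        (j.factorial * Real.Gamma (j + c)))
      (Real.Gamma a * Real.Gamma b * Real.Gamma (c - a - b) /
        (Real.Gamma (c - a) * Real.Gamma (c - b))) := by
  have hcb : 0 < c - b := by linarith
  have hca : 0 < c - a := by linarith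
  have hcab : 0 < c - b - a := by linarith
  have key := hasSum_integral_of_nonneg_of_hasSum (μ := volume.restrict (Ioo (0 : ℝ) 1))
    (F := fun (j : ℕ) x => (Real.Gamma (j + a) * x ^ j / j.factorial) *
      (x ^ (b - 1) * (1 - x) ^ (c - b - 1)))
    (f := fun x => Real.Gamma a * (x ^ (b - 1) * (1 - x) ^ (c - b - a - 1)))
    (fun j => Measurable.aestronglyMeasurable (by fun_prop))
    (by
      filter_upwards [ae_restrict_mem measurableSet_Ioo] with x hx j
      have := hx.1
      have : 0 < 1 - x := by linarith [hx.2]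
      have := Real.Gamma_pos_of_pos (show (0 : ℝ) < j + a by positivity)
      positivity)
    (by
      filter_upwards [ae_restrict_mem measurableSet_Ioo] with x hx
      have h1 : 0 < 1 - x := by linarith [hx.2]
      convert! (hasSum_Gamma_add_mul_pow_div_factorial ha hx.1 hx.2).mul_right
        (x ^ (b - 1) * (1 - x) ^ (c - b - 1)) using 1
      rw [show c - b - a - 1 = -a + (c - b - 1) by ring, Real.rpow_add h1]
      ring)
    ((integrableOn_Ioo_rpow_mul_one_sub_rpow hb hcab).const_mul _)
  rw [integral_const_mul, integral_Ioo_rpow_mul_one_sub_rpow hb hcab] at key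
  have g1 := Real.Gamma_pos_of_pos hcb
  convert! key.div_const (Real.Gamma (c - b)) using 1
  · ext j
    have : ∫ x in Ioo (0 : ℝ) 1, (Real.Gamma (j + a) * x ^ j / j.factorial) *
        (x ^ (b - 1) * (1 - x) ^ (c - b - 1)) = ∫ x in Ioo (0 : ℝ) 1,
        (Real.Gamma (j + a) / j.factorial) * (x ^ ((j + b) - 1) * (1 - x) ^ (c - b - 1)) := by
      refine setIntegral_congr_fun measurableSet_Ioo fun t ht => ?_
      have : t ^ ((j + b) - 1) = t ^ (b - 1) * t ^ j := by
        rw [← Real.rpow_natCast, ← Real.rpow_add ht.1]; ring_nf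
      simp only [this]
      ring
    rw [this, integral_const_mul, integral_Ioo_rpow_mul_one_sub_rpow (by positivity) hcb,
      ProbabilityTheory.beta, show (j + b + (c - b)) = j + c by ring]
    have hc0 : 0 < c := by linarith
    have := Real.Gamma_pos_of_pos (show (0 : ℝ) < j + c by positivity)
    field_simp
  · rw [ProbabilityTheory.beta, show b + (c - b - a) = c - a by ring,
      show c - b - a = c - a - b by ring]
    have := Real.Gamma_pos_of_pos hca
    field_simp

/-- The `j`-th term of the power series of the modified Bessel function `I_k` at `2 * z`. -/
noncomputable def besselTerm (z : ℝ) (k : ℤ) (j : ℕ) : ℝ :=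
  z ^ (2 * (j : ℤ) + k) / (Real.Gamma (1 + (j : ℝ)) * Real.Gamma ((j : ℝ) + (k : ℝ) + 1))

/-- The discrete heat kernel on `ℤ`. -/
noncomputable def heatKer (z : ℝ) (k : ℤ) : ℝ := Real.exp (-(2 * z)) * ∑' j : ℕ, besselTerm z k j

theorem heatS_eq (z : ℝ) (u : ℤ → ℝ) (n : ℤ) : heatS z u n = ∑' k : ℤ, heatKer z (n - k) * u k :=
  rfl

theorem besselTerm_of_nonneg (z : ℝ) {k : ℤ} {j i : ℕ} (h : (j : ℤ) + k = i) :
    besselTerm z k j = z ^ (i + j) / (j.factorial * i.factorial) := by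
  obtain rfl : k = i - j := by omega
  rw [besselTerm, show (2 * (j : ℤ) + (i - j)) = ((i + j : ℕ) : ℤ) by push_cast; ring,
    zpow_natCast, add_comm 1 (j : ℝ), Real.Gamma_nat_eq_factorial]
  push_cast
  rw [add_sub_cancel, Real.Gamma_nat_eq_factorial]

theorem besselTerm_of_neg (z : ℝ) {k : ℤ} {j : ℕ} (h : (j : ℤ) + k < 0) : besselTerm z k j = 0 := by
  obtain ⟨i, hi⟩ := Int.eq_ofNat_of_zero_le (show 0 ≤ -((j : ℤ) + k + 1) by omega)
  have : (j : ℝ) + (k : ℝ) + 1 = -(i : ℝ) := by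
    have : -((j : ℝ) + k + 1) = (i : ℝ) := by exact_mod_cast hi
    linarith
  rw [besselTerm, this, Real.Gamma_neg_nat_eq_zero, mul_zero, div_zero]

theorem besselTerm_nonneg {z : ℝ} (hz : 0 ≤ z) (k : ℤ) (j : ℕ) : 0 ≤ besselTerm z k j := by
  rcases lt_or_ge ((j : ℤ) + k) 0 with h | h
  · rw [besselTerm_of_neg z h]
  · obtain ⟨i, hi⟩ := Int.eq_ofNat_of_zero_le h
    rw [besselTerm_of_nonneg z hi]
    positivity

theorem hasSum_besselTerm_prod (z : ℝ) :
    HasSum (fun p : ℤ × ℕ => besselTerm z p.1 p.2) (Real.exp (2 * z)) := by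
  have hinj : Function.Injective (fun p : ℕ × ℕ => (((p.1 : ℤ) - p.2, p.2) : ℤ × ℕ)) := by
    rintro ⟨a, b⟩ ⟨c, d⟩ h
    simp only [Prod.mk.injEq] at h ⊢
    omega
  rw [← hinj.hasSum_iff]
  · have h : HasSum (fun i : ℕ => z ^ i / i.factorial) (Real.exp z) := by
      rw [Real.exp_eq_exp_ℝ]; exact NormedSpace.expSeries_div_hasSum_exp z
    have hs : Summable fun i : ℕ => ‖z ^ i / i.factorial‖ :=
      NormedSpace.norm_expSeries_div_summable z
    have := HasSum.mul h h (summable_mul_of_summable_norm hs hs)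
    rw [← Real.exp_add, ← two_mul] at this
    convert! this using 2 with p
    rw [Function.comp_apply, besselTerm_of_nonneg z (i := p.1) (by simp), pow_add]
    field_simp
  · rintro ⟨k, j⟩ h
    apply besselTerm_of_neg
    by_contra! h2
    obtain ⟨i, hi⟩ := Int.eq_ofNat_of_zero_le h2
    exact h ⟨(i, j), by simp only [Prod.mk.injEq, and_true]; omega⟩

theorem summable_besselTerm (z : ℝ) (k : ℤ) : Summable (besselTerm z k) :=
  (hasSum_besselTerm_prod z).summable.prod_factor k

theorem hasSum_heatKer (z : ℝ) : HasSum (heatKer z) 1 := by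
  have := ((hasSum_besselTerm_prod z).prod_fiberwise
    fun k => (summable_besselTerm z k).hasSum).mul_left (Real.exp (-(2 * z)))
  rwa [← Real.exp_add, neg_add_cancel, Real.exp_zero] at this

theorem heatKer_nonneg {z : ℝ} (hz : 0 ≤ z) (k : ℤ) : 0 ≤ heatKer z k :=
  mul_nonneg (Real.exp_pos _).le (tsum_nonneg (besselTerm_nonneg hz k))

theorem heatKer_neg_natCast (z : ℝ) (k : ℕ) : heatKer z (-k) = heatKer z k := by
  rw [heatKer, heatKer]
  congr 1
  rw [← (add_left_injective k).tsum_eq (f := besselTerm z (-k))]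
  · refine tsum_congr fun j => ?_
    rw [besselTerm_of_nonneg z (i := j) (by push_cast; ring),
      besselTerm_of_nonneg z (i := j + k) (by push_cast; ring), mul_comm, add_comm]
  · intro j hj
    by_contra h
    refine hj (besselTerm_of_neg z ?_)
    by_contra! h2
    exact h ⟨j - k, by simp only; omega⟩

theorem heatKer_natAbs (z : ℝ) (k : ℤ) : heatKer z k.natAbs = heatKer z k := by
  rcases Int.natAbs_eq k with h | h
  · rw [← h]
  · conv_rhs => rw [h]
    rw [heatKer_neg_natCast]

theorem integral_rpow_mul_heatKer_natCast {α : ℝ} (hα : 0 < α) {k : ℕ} (hk : α < k) :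
    ∫ z in Ioi (0 : ℝ), z ^ (-α - 1) * heatKer z k = 4 ^ α * Real.Gamma (1 / 2 + α) *
      Real.Gamma (k - α) / (Real.sqrt Real.pi * Real.Gamma (k + 1 + α)) := by
  have hpi : 0 < Real.sqrt Real.pi := Real.sqrt_pos.2 Real.pi_pos
  set F : ℕ → ℝ → ℝ := fun j z =>
    z ^ ((2 * j + k - α) - 1) * Real.exp (-(2 * z)) * (1 / (j.factorial * (j + k).factorial)) with hF
  have hpos : ∀ j : ℕ, 0 < 2 * (j : ℝ) + k - α := fun j => by
    have : (0 : ℝ) ≤ j := by positivity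
    linarith
  have hFint : ∀ j, IntegrableOn (F j) (Ioi 0) := fun j =>
    (integrableOn_rpow_mul_exp_neg_mul (hpos j) two_pos).mul_const _
  have hval : ∀ j, ∫ z in Ioi (0 : ℝ), F j z = 1 / (2 * Real.sqrt Real.pi) *
      (Real.Gamma (j + (k - α) / 2) * Real.Gamma (j + (k - α + 1) / 2) /
        (j.factorial * Real.Gamma (j + (k + 1)))) := by
    intro j
    rw [hF]
    simp only
    rw [integral_mul_const, Real.integral_rpow_mul_exp_neg_mul_Ioi (hpos j) two_pos]
    have := Real.Gamma_mul_Gamma_add_half (j + (k - α) / 2)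
    rw [show (j + (k - α) / 2 + 1 / 2) = j + (k - α + 1) / 2 by ring,
      show 2 * (j + (k - α) / 2) = 2 * j + k - α by ring] at this
    rw [this, show (j : ℝ) + (k + 1) = ((j + k : ℕ) : ℝ) + 1 by push_cast; ring,
      Real.Gamma_nat_eq_factorial, Real.rpow_sub two_pos, Real.rpow_one, one_div,
      Real.inv_rpow two_pos.le]
    field_simp
  have hgauss := (hasSum_Gamma_mul_Gamma_div_Gamma (a := (k - α) / 2) (b := (k - α + 1) / 2)
    (c := k + 1) (by linarith) (by linarith) (by linarith)).mul_left (1 / (2 * Real.sqrt Real.pi))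
  have hnorm : ∀ j, ∫ z in Ioi (0 : ℝ), ‖F j z‖ = ∫ z in Ioi (0 : ℝ), F j z := fun j => by
    refine setIntegral_congr_fun measurableSet_Ioi fun z hz => Real.norm_of_nonneg ?_
    have : 0 < z := hz
    simp only [hF]
    positivity
  have key := hasSum_integral_of_summable_integral_norm hFint
    (by simp only [hnorm, hval]; exact hgauss.summable)
  simp only [hval] at key
  have h1 : ∫ z in Ioi (0 : ℝ), z ^ (-α - 1) * heatKer z k = ∫ z in Ioi (0 : ℝ), ∑' j, F j z := by
    refine setIntegral_congr_fun measurableSet_Ioi fun z hz => ?_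
    have hz : 0 < z := hz
    simp only [heatKer]
    rw [← mul_assoc, ← tsum_mul_left]
    refine tsum_congr fun j => ?_
    rw [besselTerm_of_nonneg z (i := j + k) (by push_cast; ring), hF]
    simp only
    rw [show (2 * j + k - α) - 1 = (-α - 1) + ((j + k + j : ℕ) : ℝ) by push_cast; ring,
      Real.rpow_add hz, Real.rpow_natCast]
    ring
  rw [h1, key.unique hgauss]
  have d1 := Real.Gamma_mul_Gamma_add_half ((k - α) / 2)
  have d2 := Real.Gamma_mul_Gamma_add_half ((k + 1 + α) / 2)
  rw [show (k - α) / 2 + 1 / 2 = (k - α + 1) / 2 by ring, mul_div_cancel₀ _ two_ne_zero] at d1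
  rw [mul_div_cancel₀ _ two_ne_zero, mul_comm (Real.Gamma _)] at d2
  rw [d1, show (k : ℝ) + 1 - (k - α) / 2 - (k - α + 1) / 2 = 1 / 2 + α by ring,
    show (k : ℝ) + 1 - (k - α) / 2 = (k + 1 + α) / 2 + 1 / 2 by ring,
    show (k : ℝ) + 1 - (k - α + 1) / 2 = (k + 1 + α) / 2 by ring, d2]
  have e1 : (2 : ℝ) ^ (1 - (k - α)) = 2 * 4 ^ α * 2 ^ (1 - (k + 1 + α)) := by
    rw [show (4 : ℝ) = 2 ^ (2 : ℝ) by norm_num, ← Real.rpow_mul two_pos.le]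
    nth_rw 2 [← Real.rpow_one 2]
    rw [← Real.rpow_add two_pos, ← Real.rpow_add two_pos]
    ring_nf
  have := Real.Gamma_pos_of_pos (show 0 < (k : ℝ) + 1 + α by positivity)
  have : (0 : ℝ) < 2 ^ (1 - (k + 1 + α)) := by positivity
  rw [e1]
  field_simp

theorem integrableOn_rpow_mul_heatKer_natCast {α : ℝ} (hα : 0 < α) {k : ℕ} (hk : α < k) :
    IntegrableOn (fun z => z ^ (-α - 1) * heatKer z k) (Ioi 0) := by
  by_contra h
  have h1 := integral_rpow_mul_heatKer_natCast hα hk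
  rw [integral_undef h] at h1
  have := Real.Gamma_pos_of_pos (show 0 < (k : ℝ) + 1 + α by positivity)
  have := Real.Gamma_pos_of_pos (show 0 < (k : ℝ) - α by linarith)
  have := Real.Gamma_pos_of_pos (show 0 < 1 / 2 + α by positivity)
  have : 0 < Real.sqrt Real.pi := Real.sqrt_pos.2 Real.pi_pos
  refine (ne_of_lt ?_) h1
  positivity

/-- The convolution kernel of the fractional discrete Laplacian: the opposite of `fracKer` off the
diagonal, and the same closed formula on the diagonal. -/
noncomputable def fracConvKer (s : ℝ) (k : ℤ) : ℝ :=
  (4 : ℝ) ^ s * Real.Gamma (1 / 2 + s) * Real.Gamma (|(k : ℝ)| - s) /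
    (Real.sqrt Real.pi * Real.Gamma (-s) * Real.Gamma (|(k : ℝ)| + 1 + s))

theorem fracKer_eq (s : ℝ) (k : ℤ) : fracKer s k = if k = 0 then 0 else -fracConvKer s k := by
  rw [fracKer, fracConvKer, neg_div]

theorem fracConvKer_neg (s : ℝ) (k : ℤ) : fracConvKer s (-k) = fracConvKer s k := by
  simp [fracConvKer]

theorem fracConvKer_natCast (s : ℝ) (k : ℕ) : fracConvKer s k =
    (4 : ℝ) ^ s * Real.Gamma (1 / 2 + s) * Real.Gamma (k - s) /
      (Real.sqrt Real.pi * Real.Gamma (-s) * Real.Gamma (k + 1 + s)) := by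
  simp [fracConvKer]

theorem fracConvKer_add_one_natCast {s : ℝ} (hs : 0 < s) (hs' : ∀ n : ℕ, s ≠ n) (k : ℕ) :
    fracConvKer (s + 1) k = negLap (fracConvKer s) k := by
  have hpi : Real.sqrt Real.pi ≠ 0 := (Real.sqrt_pos.2 Real.pi_pos).ne'
  have g0 : Real.Gamma (-s) = -(s + 1) * Real.Gamma (-(s + 1)) := by
    rw [← Real.Gamma_add_one (by linarith)]; ring_nf
  have gne : Real.Gamma (-(s + 1)) ≠ 0 := by
    refine Real.Gamma_ne_zero fun m h => ?_
    rcases m with _ | m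
    · norm_num at h; linarith
    · exact hs' m (by push_cast at h; linarith)
  have gh : Real.Gamma (1 / 2 + (s + 1)) = (1 / 2 + s) * Real.Gamma (1 / 2 + s) := by
    rw [← add_assoc, Real.Gamma_add_one (by linarith)]
  have gh0 : Real.Gamma (1 / 2 + s) ≠ 0 := (Real.Gamma_pos_of_pos (by linarith)).ne'
  have h4 : (4 : ℝ) ^ (s + 1) = 4 ^ s * 4 := by rw [Real.rpow_add_one (by norm_num)]
  have hs1 : s + 1 ≠ 0 := by linarith
  rcases k with _ | k
  · have : negLap (fracConvKer s) ((0 : ℕ) : ℤ) =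
        2 * fracConvKer s (0 : ℕ) - 2 * fracConvKer s (1 : ℕ) := by
      have h := fracConvKer_neg s 1
      simp only [negLap, Nat.cast_zero, Nat.cast_one, zero_sub, zero_add] at h ⊢
      rw [h]; ring
    rw [this]
    simp only [fracConvKer_natCast]
    simp only [Nat.cast_zero, Nat.cast_one, zero_sub, zero_add, h4, gh]
    have e1 : Real.Gamma (1 - s) = -s * Real.Gamma (-s) := by
      rw [← Real.Gamma_add_one (by linarith)]; ring_nf
    have e2 : Real.Gamma (1 + (s + 1)) = (1 + s) * Real.Gamma (1 + s) := by
      rw [← Real.Gamma_add_one (by linarith)]; ring_nf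
    have e3 : Real.Gamma (1 + 1 + s) = (1 + s) * Real.Gamma (1 + s) := by
      rw [← Real.Gamma_add_one (by linarith)]; ring_nf
    have e4 : Real.Gamma (1 + s) ≠ 0 := (Real.Gamma_pos_of_pos (by linarith)).ne'
    have hs2 : 1 + s ≠ 0 := by linarith
    rw [e1, e2, e3, g0]
    field_simp
    ring
  · have hk : (k : ℝ) - s ≠ 0 := fun h => hs' k (by linarith)
    have hk1 : (k : ℝ) + 1 - s ≠ 0 := fun h => hs' (k + 1) (by push_cast; linarith)
    have hk0 : (0 : ℝ) ≤ k := by positivity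
    have : negLap (fracConvKer s) ((k + 1 : ℕ) : ℤ) = 2 * fracConvKer s (k + 1 : ℕ) -
        fracConvKer s (k : ℕ) - fracConvKer s (k + 1 + 1 : ℕ) := by
      simp [negLap]
    rw [this]
    simp only [fracConvKer_natCast]
    simp only [Nat.cast_add, Nat.cast_one, h4, gh]
    have e1 : Real.Gamma (k + 1 - s) = (k - s) * Real.Gamma (k - s) := by
      rw [← Real.Gamma_add_one hk]; ring_nf
    have e2 : Real.Gamma (k + 1 + 1 - s) = (k + 1 - s) * ((k - s) * Real.Gamma (k - s)) := by
      rw [← e1, ← Real.Gamma_add_one hk1]; ring_nf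
    have e3 : Real.Gamma (k + 1 + 1 + s) = (k + 1 + s) * Real.Gamma (k + 1 + s) := by
      rw [← Real.Gamma_add_one (by linarith)]; ring_nf
    have e4 : Real.Gamma (k + 1 + 1 + 1 + s) =
        (k + 1 + 1 + s) * ((k + 1 + s) * Real.Gamma (k + 1 + s)) := by
      rw [← e3, ← Real.Gamma_add_one (by linarith)]; ring_nf
    have e5 : Real.Gamma (k + 1 + s) ≠ 0 := (Real.Gamma_pos_of_pos (by linarith)).ne'
    rw [show (k : ℝ) + 1 - (s + 1) = k - s by ring,
      show (k : ℝ) + 1 + 1 + (s + 1) = k + 1 + 1 + 1 + s by ring, e1, e2, e3, e4, g0]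
    have hs2 : (k : ℝ) + 1 + s ≠ 0 := by linarith
    have hs3 : (k : ℝ) + 1 + 1 + s ≠ 0 := by linarith
    field_simp
    ring

theorem fracConvKer_add_one {s : ℝ} (hs : 0 < s) (hs' : ∀ n : ℕ, s ≠ n) :
    fracConvKer (s + 1) = negLap (fracConvKer s) := by
  ext k
  obtain ⟨j, rfl | rfl⟩ := Int.eq_nat_or_neg k
  · exact fracConvKer_add_one_natCast hs hs' j
  · rw [fracConvKer_neg, fracConvKer_add_one_natCast hs hs' j]
    simp only [negLap]
    rw [fracConvKer_neg, ← fracConvKer_neg s (j - 1), ← fracConvKer_neg s (j + 1),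
      show -((j : ℤ) - 1) = -j + 1 by ring, show -((j : ℤ) + 1) = -j - 1 by ring]
    ring

theorem hasSum_Gamma_sub_div_Gamma_add {s : ℝ} (hs : 0 < s) (hs1 : s < 1) :
    HasSum (fun k : ℕ => Real.Gamma (k + 1 - s) / Real.Gamma (k + 1 + 1 + s))
      (Real.Gamma (1 - s) / Real.Gamma (1 + s) / (2 * s)) := by
  set g : ℕ → ℝ := fun k => Real.Gamma (k + 1 - s) / Real.Gamma (k + 1 + s) with hg
  set t : ℕ → ℝ := fun k => Real.Gamma (k + 1 - s) / Real.Gamma (k + 1 + 1 + s) with ht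
  have hk0 : ∀ k : ℕ, (0 : ℝ) ≤ k := fun k => by positivity
  have P1 : ∀ k : ℕ, 0 < Real.Gamma (k + 1 - s) := fun k =>
    Real.Gamma_pos_of_pos (by linarith [hk0 k])
  have P2 : ∀ k : ℕ, 0 < Real.Gamma (k + 1 + s) := fun k =>
    Real.Gamma_pos_of_pos (by linarith [hk0 k])
  have e : ∀ k : ℕ, Real.Gamma (k + 1 + 1 + s) = (k + 1 + s) * Real.Gamma (k + 1 + s) := fun k => by
    rw [← Real.Gamma_add_one (by linarith [hk0 k])]; ring_nf
  have htg : ∀ k : ℕ, t k = g k / (k + 1 + s) := fun k => by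
    simp only [ht, hg, e]
    have := hk0 k
    have := P2 k
    field_simp
  have hgpos : ∀ k, 0 < g k := fun k => div_pos (P1 k) (P2 k)
  have htpos : ∀ k, 0 ≤ t k := fun k => by
    rw [htg]; have := hgpos k; positivity
  have hdiff : ∀ k, 2 * s * t k = g k - g (k + 1) := fun k => by
    have h1 : Real.Gamma (k + 1 + 1 - s) = (k + 1 - s) * Real.Gamma (k + 1 - s) := by
      rw [← Real.Gamma_add_one (by linarith [hk0 k])]; ring_nf
    simp only [ht, hg, Nat.cast_add, Nat.cast_one, e, h1]
    have := hk0 k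
    have := P2 k
    have : (0 : ℝ) < k + 1 + s := by positivity
    field_simp
    ring
  have hanti : Antitone g := antitone_nat_of_succ_le fun k => by
    have := hdiff k
    have : 0 ≤ 2 * s * t k := mul_nonneg (by positivity) (htpos k)
    linarith
  have hbdd : BddBelow (range g) := ⟨0, by rintro _ ⟨k, rfl⟩; exact (hgpos k).le⟩
  have hlim := tendsto_atTop_ciInf hanti hbdd
  set L := ⨅ k, g k with hL
  have hLg : ∀ k, L ≤ g k := fun k => ciInf_le hbdd k
  have hsum : HasSum (fun k => 2 * s * t k) (g 0 - L) := by
    rw [hasSum_iff_tendsto_nat_of_nonneg (fun k => mul_nonneg (by positivity) (htpos k))]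
    simp only [hdiff, Finset.sum_range_sub']
    exact tendsto_const_nhds.sub hlim
  have hL0 : L = 0 := by
    by_contra hne
    have hLpos : 0 < L := lt_of_le_of_ne (le_ciInf fun k => (hgpos k).le) (Ne.symm hne)
    have h1 : Summable t := by
      convert! hsum.summable.div_const (2 * s) using 2 with k
      field_simp
    have h2 : Summable fun k : ℕ => L * (1 / ((k + 2 : ℕ) : ℝ)) := by
      refine Summable.of_nonneg_of_le (fun k => by positivity) (fun k => ?_) h1
      rw [htg, mul_one_div]
      have := hk0 k
      have := hgpos k
      gcongr
      · exact hLg k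
      · push_cast; linarith
    rw [summable_mul_left_iff hne, summable_nat_add_iff 2 (f := fun k : ℕ => 1 / (k : ℝ))] at h2
    exact Real.not_summable_one_div_natCast h2
  rw [hL0, sub_zero] at hsum
  convert! hsum.div_const (2 * s) using 1
  · ext k; field_simp
  · simp [hg]

theorem hasSum_fracConvKer_of_lt_one {s : ℝ} (hs : 0 < s) (hs1 : s < 1) :
    HasSum (fracConvKer s) 0 := by
  set C := (4 : ℝ) ^ s * Real.Gamma (1 / 2 + s) / (Real.sqrt Real.pi * Real.Gamma (-s)) with hC
  have h1 : HasSum (fun k : ℕ => fracConvKer s (k + 1 : ℕ))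
      (C * (Real.Gamma (1 - s) / Real.Gamma (1 + s) / (2 * s))) := by
    convert! (hasSum_Gamma_sub_div_Gamma_add hs hs1).mul_left C using 2 with k
    rw [fracConvKer_natCast, hC]
    push_cast
    ring
  have h2 : HasSum (fun k : ℕ => fracConvKer s k) _ := (hasSum_nat_add_iff 1).1 h1
  have h3 : HasSum (fun k : ℕ => fracConvKer s (-(k + 1 : ℤ)))
      (C * (Real.Gamma (1 - s) / Real.Gamma (1 + s) / (2 * s))) := by
    simp only [fracConvKer_neg]
    exact_mod_cast h1
  convert! h2.of_nat_of_neg_add_one h3 using 1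
  have e1 : Real.Gamma (1 - s) = -s * Real.Gamma (-s) := by
    rw [← Real.Gamma_add_one (by linarith)]; ring_nf
  have g0 : Real.Gamma (-s) ≠ 0 := fun h => by
    have := Real.Gamma_pos_of_pos (show 0 < 1 - s by linarith)
    rw [e1, h] at this
    simp at this
  have g1 := Real.Gamma_pos_of_pos (show 0 < 1 + s by linarith)
  have hpi : 0 < Real.sqrt Real.pi := Real.sqrt_pos.2 Real.pi_pos
  rw [Finset.sum_range_one, fracConvKer_natCast, hC, e1]
  simp only [Nat.cast_zero, zero_sub, zero_add]
  field_simp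
  ring

theorem HasSum.negLap {f : ℤ → ℝ} {a : ℝ} (h : HasSum f a) : HasSum (negLap f) 0 := by
  have h1 := (Equiv.subRight (1 : ℤ)).hasSum_iff.2 h
  have h2 := (Equiv.addRight (1 : ℤ)).hasSum_iff.2 h
  convert! ((h.mul_left 2).sub h1).sub h2 using 1
  ring

theorem add_natCast_ne_natCast {α : ℝ} (h0 : 0 < α) (h1 : α < 1) (l n : ℕ) : α + l ≠ n := by
  intro h
  have h2 : l < n := by exact_mod_cast (show (l : ℝ) < n by linarith)
  have h3 : n < l + 1 := by exact_mod_cast (show (n : ℝ) < l + 1 by linarith)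
  omega

theorem hasSum_fracConvKer {α : ℝ} (h0 : 0 < α) (h1 : α < 1) (l : ℕ) :
    HasSum (fracConvKer (α + l)) 0 := by
  induction l with
  | zero => simpa using hasSum_fracConvKer_of_lt_one h0 h1
  | succ l ih =>
    rw [Nat.cast_succ, ← add_assoc,
      fracConvKer_add_one (by positivity) (add_natCast_ne_natCast h0 h1 l)]
    exact ih.negLap

theorem Summable.comp_sub_left_mul_bounded {a w : ℤ → ℝ} (ha : Summable a) {C : ℝ}
    (hw : ∀ k, |w k| ≤ C) (n : ℤ) : Summable fun k => a (n - k) * w k := by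
  refine Summable.of_norm_bounded
    (((Equiv.subLeft n).summable_iff.2 ha).norm.mul_right C) fun k => ?_
  rw [norm_mul]
  exact mul_le_mul_of_nonneg_left (hw k) (norm_nonneg _)

theorem abs_negLap_le {w : ℤ → ℝ} {C : ℝ} (hw : ∀ k, |w k| ≤ C) (k : ℤ) :
    |negLap w k| ≤ 4 * C := by
  have h1 := abs_le.1 (hw k)
  have h2 := abs_le.1 (hw (k - 1))
  have h3 := abs_le.1 (hw (k + 1))
  rw [negLap, abs_le]
  constructor <;> linarith

theorem tsum_comp_sub_left_mul_negLap {a w : ℤ → ℝ} (ha : Summable a) {C : ℝ}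
    (hw : ∀ k, |w k| ≤ C) (n : ℤ) :
    ∑' k, a (n - k) * negLap w k = ∑' k, negLap a (n - k) * w k := by
  have h0 := ha.comp_sub_left_mul_bounded hw n
  have h1 := ha.comp_sub_left_mul_bounded hw (n - 1)
  have h2 := ha.comp_sub_left_mul_bounded hw (n + 1)
  have e1 := (Equiv.subRight (1 : ℤ)).hasSum_iff.2 h1.hasSum
  have e2 := (Equiv.addRight (1 : ℤ)).hasSum_iff.2 h2.hasSum
  refine HasSum.tsum_eq (f := fun k => a (n - k) * negLap w k) ?_
  have e3 := ((h0.hasSum.mul_left 2).sub h1.hasSum).sub h2.hasSum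
  convert! ((h0.hasSum.mul_left 2).sub e1).sub e2 using 1
  · ext k
    simp only [negLap, Function.comp_apply, Equiv.subRight_apply, Equiv.coe_addRight]
    rw [show n - 1 - (k - 1) = n - k by ring, show n + 1 - (k + 1) = n - k by ring]
    ring
  · rw [← e3.tsum_eq]
    refine tsum_congr fun k => ?_
    simp only [negLap]
    rw [show n - 1 - k = n - k - 1 by ring, show n + 1 - k = n - k + 1 by ring]
    ring

theorem tsum_fracConvKer_mul_negLap_iterate {α : ℝ} (h0 : 0 < α) (h1 : α < 1) (n : ℤ) (l : ℕ)
    {w : ℤ → ℝ} {C : ℝ} (hw : ∀ k, |w k| ≤ C) :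
    ∑' k, fracConvKer α (n - k) * negLap^[l] w k = ∑' k, fracConvKer (α + l) (n - k) * w k := by
  induction l generalizing w C with
  | zero => simp
  | succ l ih =>
    rw [Function.iterate_succ_apply, ih (abs_negLap_le hw),
      tsum_comp_sub_left_mul_negLap (hasSum_fracConvKer h0 h1 l).summable hw,
      ← fracConvKer_add_one (by positivity) (add_natCast_ne_natCast h0 h1 l)]
    push_cast
    rw [add_assoc]

theorem fracKer_mul_sub_eq (s : ℝ) (w : ℤ → ℝ) (n k : ℤ) :
    fracKer s (n - k) * (w n - w k) =
      fracConvKer s (n - k) * w k - fracConvKer s (n - k) * w n := by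
  rw [fracKer_eq]
  split_ifs with h
  · obtain rfl : n = k := by omega
    ring
  · ring

theorem hasSum_fracKer_mul_sub {s : ℝ} (hs : HasSum (fracConvKer s) 0) {w : ℤ → ℝ} {C : ℝ}
    (hw : ∀ k, |w k| ≤ C) (n : ℤ) :
    HasSum (fun k => fracKer s (n - k) * (w n - w k)) (∑' k, fracConvKer s (n - k) * w k) := by
  simp only [fracKer_mul_sub_eq]
  simpa using (hs.summable.comp_sub_left_mul_bounded hw n).hasSum.sub
    (((Equiv.subLeft n).hasSum_iff.2 hs).mul_right (w n))

theorem integral_rpow_mul_heatKer {α : ℝ} (h0 : 0 < α) (h1 : α < 1) {k : ℤ} (hk : k ≠ 0) :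
    IntegrableOn (fun z => z ^ (-α - 1) * heatKer z k) (Ioi 0) ∧
      ∫ z in Ioi (0 : ℝ), z ^ (-α - 1) * heatKer z k = Real.Gamma (-α) * fracConvKer α k := by
  have hk1 : 1 ≤ k.natAbs := Int.natAbs_pos.2 hk
  have hk2 : α < k.natAbs := h1.trans_le (by exact_mod_cast hk1)
  have g0 : Real.Gamma (-α) ≠ 0 := by
    refine Real.Gamma_ne_zero fun m h => add_natCast_ne_natCast h0 h1 0 m ?_
    simpa using h
  have i1 := integrableOn_rpow_mul_heatKer_natCast h0 hk2
  have i2 := integral_rpow_mul_heatKer_natCast h0 hk2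
  simp only [heatKer_natAbs] at i1 i2
  refine ⟨i1, ?_⟩
  rw [i2, fracConvKer, Nat.cast_natAbs, Int.cast_abs]
  have : Real.sqrt Real.pi ≠ 0 := (Real.sqrt_pos.2 Real.pi_pos).ne'
  field_simp

theorem integral_heatS_sub {α : ℝ} (h0 : 0 < α) (h1 : α < 1) {v : ℤ → ℝ} {C : ℝ}
    (hv : ∀ k, |v k| ≤ C) (n : ℤ) :
    1 / Real.Gamma (-α) * (∫ z in Ioi (0 : ℝ), z ^ (-α - 1) * (heatS z v n - v n)) =
      ∑' k, fracConvKer α (n - k) * v k := by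
  have g0 : Real.Gamma (-α) ≠ 0 := by
    refine Real.Gamma_ne_zero fun m h => add_natCast_ne_natCast h0 h1 0 m ?_
    simpa using h
  have hA := hasSum_fracConvKer_of_lt_one h0 h1
  set F : ℤ → ℝ → ℝ := fun k z => z ^ (-α - 1) * heatKer z (n - k) * (v k - v n) with hF
  have hFint : ∀ k, IntegrableOn (F k) (Ioi 0) := fun k => by
    by_cases hk : k = n
    · subst hk; simp [hF]
    · exact (integral_rpow_mul_heatKer h0 h1 (by omega)).1.mul_const _
  have hval : ∀ k, ∫ z in Ioi (0 : ℝ), F k z =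
      Real.Gamma (-α) * (fracKer α (n - k) * (v n - v k)) := fun k => by
    by_cases hk : k = n
    · subst hk; simp [hF]
    · simp only [hF]
      rw [integral_mul_const, (integral_rpow_mul_heatKer h0 h1 (by omega)).2, fracKer_mul_sub_eq]
      ring
  have hnorm : ∀ k, ∫ z in Ioi (0 : ℝ), ‖F k z‖ = |∫ z in Ioi (0 : ℝ), F k z| := fun k => by
    simp only [hF]
    rw [integral_mul_const, abs_mul, abs_of_nonneg, ← integral_mul_const]
    · refine setIntegral_congr_fun measurableSet_Ioi fun z hz => ?_
      have hz : 0 < z := hz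
      have := heatKer_nonneg hz.le (n - k)
      rw [norm_mul, Real.norm_of_nonneg (by positivity), Real.norm_eq_abs]
    · refine setIntegral_nonneg measurableSet_Ioi fun z hz => ?_
      have hz : 0 < z := hz
      have := heatKer_nonneg hz.le (n - k)
      positivity
  have hS := (hasSum_fracKer_mul_sub hA hv n).mul_left (Real.Gamma (-α))
  have key := hasSum_integral_of_summable_integral_norm hFint
    (by simp only [hnorm, hval]; exact hS.summable.abs)
  simp only [hval] at key
  have h2 : ∫ z in Ioi (0 : ℝ), z ^ (-α - 1) * (heatS z v n - v n) =
      ∫ z in Ioi (0 : ℝ), ∑' k, F k z := by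
    refine setIntegral_congr_fun measurableSet_Ioi fun z hz => ?_
    have hH := hasSum_heatKer z
    have hK := (hH.summable.comp_sub_left_mul_bounded hv n).hasSum.sub
      (((Equiv.subLeft n).hasSum_iff.2 hH).mul_right (v n))
    rw [heatS_eq, ← one_mul (v n), ← hK.tsum_eq, ← tsum_mul_left]
    refine tsum_congr fun k => ?_
    simp only [hF, Function.comp_apply, Equiv.subLeft_apply]
    ring
  rw [h2, key.unique hS]
  field_simp

theorem exists_abs_le_of_summable_sq {u : ℤ → ℝ} (hu : Summable fun k => u k ^ 2) :
    ∃ C, ∀ k, |u k| ≤ C :=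
  ⟨Real.sqrt (∑' k, u k ^ 2), fun k =>
    Real.abs_le_sqrt (hu.le_tsum k fun j _ => sq_nonneg (u j))⟩

theorem exists_abs_negLap_iterate_le {w : ℤ → ℝ} {C : ℝ} (hw : ∀ k, |w k| ≤ C) (l : ℕ) :
    ∃ D, ∀ k, |negLap^[l] w k| ≤ D := by
  induction l generalizing w C with
  | zero => exact ⟨C, hw⟩
  | succ l ih => exact ih (abs_negLap_le hw)

/-- Let `m ∈ ℕ` and `s ∈ (m−1, m)`. Then for every `u ∈ ℓ²(ℤ)` and
every `n ∈ ℤ`, the series `∑_{k∈ℤ} K_s(n−k)(u(n) − u(k))` converges (absolutely,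
i.e. it is summable) and the discrete fractional Laplace operator of order `s`,
defined via the heat-semigroup integral
`((−Δ)^s u)(n) = (1/Γ(−(s−m+1))) ∫_0^∞ z^{−(s−m+1)−1} [(S_z(Δ) − I)((−Δ)^{m−1}u)](n) dz`,
satisfies `((−Δ)^s u)(n) = ∑_{k∈ℤ} K_s(n−k)(u(n) − u(k))`. -/
theorem stmt17 (m : ℕ) (hm : 1 ≤ m) (s : ℝ) (hs1 : (m : ℝ) - 1 < s) (hs2 : s < m)
    (u : ℤ → ℝ) (hu : Summable (fun k : ℤ => (u k) ^ 2)) (n : ℤ) :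
    Summable (fun k : ℤ => fracKer s (n - k) * (u n - u k)) ∧
    (1 / Real.Gamma (-(s - (m : ℝ) + 1))) *
        (∫ z in Set.Ioi (0 : ℝ), z ^ (-(s - (m : ℝ) + 1) - 1) *
          (heatS z (negLap^[m - 1] u) n - negLap^[m - 1] u n))
      = ∑' k : ℤ, fracKer s (n - k) * (u n - u k) := by
  obtain ⟨C, hC⟩ := exists_abs_le_of_summable_sq hu
  obtain ⟨l, rfl⟩ := Nat.exists_eq_add_of_le' hm
  obtain ⟨α, rfl⟩ : ∃ α, s = α + l := ⟨s - l, by ring⟩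
  push_cast at hs1 hs2 ⊢
  have h0 : 0 < α := by linarith
  have h1 : α < 1 := by linarith
  have hsum := hasSum_fracKer_mul_sub (hasSum_fracConvKer h0 h1 l) hC n
  obtain ⟨D, hD⟩ := exists_abs_negLap_iterate_le hC l
  refine ⟨hsum.summable, ?_⟩
  rw [hsum.tsum_eq, ← tsum_fracConvKer_mul_negLap_iterate h0 h1 n l hC,
    ← integral_heatS_sub h0 h1 hD n, show α + l - (l + 1) + 1 = α by ring]
end
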